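/- Let n ≥ 1. The operator g ↦ ∫_{ℝⁿ} sup_{t>0} |t ∂_t T_t^𝒜(x,y)| χ_{N^c}(x,y) g(y) dy is of weak type (1,1) with respect to γ₋₁: there exists C > 0 such that for every measurable g : ℝⁿ → [0,∞] with ∫ g γ₋₁ dy < ∞ and every λ > 0, γ₋₁({x ∈ ℝⁿ : ∫_{ℝⁿ} sup_{t>0} |t ∂_t T_t^𝒜(x,y)| χ_{N^c}(x,y) g(y) dy > λ}) ≤ C λ^{−1} ∫_{ℝⁿ} g(y) γ₋₁(y) dy. -/

import Mathlib

open MeasureTheory Real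
open scoped ENNReal

/-- The inverse Gaussian measure `γ₋₁` on `ℝⁿ`, with density `π^{n/2} e^{|x|²}`
with respect to Lebesgue measure. -/
noncomputable def gammaM1 (n : ℕ) : Measure (EuclideanSpace ℝ (Fin n)) :=
  volume.withDensity fun x => ENNReal.ofReal (Real.pi ^ ((n : ℝ) / 2) * Real.exp (‖x‖ ^ 2))

/-- The local region `N = {(x,y) : |x-y| ≤ min(1, 1/|x|)}`. -/
def localN (n : ℕ) : Set (EuclideanSpace ℝ (Fin n) × EuclideanSpace ℝ (Fin n)) :=
  {p | ‖p.1 - p.2‖ ≤ 1 ∧ ‖p.1 - p.2‖ * ‖p.1‖ ≤ 1}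

/-- The kernel `T_t^𝒜(x,y)` of the semigroup generated by `-𝒜`, where
`𝒜 = -½Δ - x·∇` on `ℝⁿ`. -/
noncomputable def heatKerA (n : ℕ) (t : ℝ) (x y : EuclideanSpace ℝ (Fin n)) : ℝ :=
  Real.exp (-(n : ℝ) * t) * Real.pi ^ (-(n : ℝ) / 2) *
    (1 - Real.exp (-2 * t)) ^ (-(n : ℝ) / 2) *
    Real.exp (-‖x - Real.exp (-t) • y‖ ^ 2 / (1 - Real.exp (-2 * t)))

theorem sum_exp_neg_sq_le_of_separated (m : ℕ) (A : ℝ) :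
    ∃ C : ℝ, 0 < C ∧ ∀ {ι : Type} (s : Finset ι) (ξ : ι → EuclideanSpace ℝ (Fin m)) (a δ : ℝ),
      0 < a → 0 < δ → a * δ ^ 2 ≤ A →
      (∀ i ∈ s, ∀ j ∈ s, i ≠ j → δ ≤ ‖ξ i - ξ j‖) →
      δ ^ m * ∑ i ∈ s, exp (-a * ‖ξ i‖ ^ 2) ≤ C * (√a)⁻¹ ^ m := by
  set v : ℝ := volume.real (Metric.ball (0 : EuclideanSpace ℝ (Fin m)) 1) with hv
  have hv0 : 0 < v := by
    rw [hv, measureReal_def]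
    exact ENNReal.toReal_pos (Metric.measure_ball_pos _ _ one_pos).ne' measure_ball_lt_top.ne
  refine ⟨2 ^ m * exp A * √(2 * π) ^ m / v, by positivity, ?_⟩
  intro ι s ξ a δ ha hδ hA hsep
  have hgauss : Integrable (fun z : EuclideanSpace ℝ (Fin m) => exp (-(a / 2) * ‖z‖ ^ 2)) := by
    have := (GaussianFourier.integrable_cexp_neg_mul_sq_norm_add (V := EuclideanSpace ℝ (Fin m))
      (b := (a / 2 : ℂ)) (by simpa using ha) 0 0).norm
    refine this.congr (Filter.Eventually.of_forall fun z => ?_)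
    simp only [Complex.norm_exp]
    congr 1
    simp [← Complex.ofReal_pow]
  have hval : ∫ z : EuclideanSpace ℝ (Fin m), exp (-(a / 2) * ‖z‖ ^ 2)
      = (√(2 * π) * (√a)⁻¹) ^ m := by
    have h := GaussianFourier.integral_rexp_neg_mul_sq_norm
      (V := EuclideanSpace ℝ (Fin m)) (b := a / 2) (by positivity)
    rw [h, finrank_euclideanSpace_fin, ← Real.sqrt_inv, ← Real.sqrt_mul (by positivity),
      ← Real.rpow_natCast, Real.sqrt_eq_rpow, ← Real.rpow_mul (by positivity)]
    congr 1
    · field_simp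
    · ring
  have hball : ∀ i, volume.real (Metric.ball (ξ i) (δ / 2)) = (δ / 2) ^ m * v := by
    intro i
    rw [measureReal_def, Measure.addHaar_ball_of_pos _ _ (by positivity),
      finrank_euclideanSpace_fin, ENNReal.toReal_mul, ENNReal.toReal_ofReal (by positivity)]
    rfl
  have hdisj : (s : Set ι).Pairwise (Function.onFun Disjoint fun i => Metric.ball (ξ i) (δ / 2)) := by
    intro i hi j hj hij
    refine Metric.ball_disjoint_ball ?_
    rw [dist_eq_norm]
    linarith [hsep i hi j hj hij]
  have hterm : ∀ i ∈ s, (δ / 2) ^ m * v * exp (-a * ‖ξ i‖ ^ 2) ≤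
      exp A * ∫ z in Metric.ball (ξ i) (δ / 2), exp (-(a / 2) * ‖z‖ ^ 2) := by
    intro i _
    rw [← hball i, ← integral_const_mul, ← smul_eq_mul, ← setIntegral_const]
    refine setIntegral_mono_on ?_ (hgauss.const_mul _).integrableOn measurableSet_ball ?_
    · exact integrableOn_const measure_ball_lt_top.ne
    · intro z hz
      rw [← exp_add]
      refine exp_le_exp.2 ?_
      rw [Metric.mem_ball, dist_eq_norm] at hz
      have h1 : ‖z‖ ≤ ‖ξ i‖ + δ / 2 := by
        have := norm_le_norm_add_norm_sub' z (ξ i)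
        linarith
      have h2 : ‖z‖ ^ 2 ≤ 2 * ‖ξ i‖ ^ 2 + 2 * (δ / 2) ^ 2 := by
        nlinarith [norm_nonneg z, sq_nonneg (‖ξ i‖ - δ / 2)]
      nlinarith [mul_le_mul_of_nonneg_left h2 ha.le, mul_pos ha (pow_pos hδ 2)]
  have hsum : (δ / 2) ^ m * v * ∑ i ∈ s, exp (-a * ‖ξ i‖ ^ 2) ≤
      exp A * (√(2 * π) * (√a)⁻¹) ^ m := by
    rw [Finset.mul_sum]
    refine (Finset.sum_le_sum hterm).trans ?_
    rw [← Finset.mul_sum, ← integral_biUnion_finset s (fun _ _ => measurableSet_ball) hdisj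
      (fun _ _ => hgauss.integrableOn), ← hval]
    refine mul_le_mul_of_nonneg_left ?_ (exp_pos _).le
    exact setIntegral_le_integral hgauss (Filter.Eventually.of_forall fun _ => (exp_pos _).le)
  rw [mul_pow, div_pow] at hsum
  have e1 : 2 ^ m * exp A * √(2 * π) ^ m / v * (√a)⁻¹ ^ m
      = 2 ^ m / v * (exp A * (√(2 * π) ^ m * (√a)⁻¹ ^ m)) := by ring
  have e2 : δ ^ m * ∑ i ∈ s, exp (-a * ‖ξ i‖ ^ 2)
      = 2 ^ m / v * (δ ^ m / 2 ^ m * v * ∑ i ∈ s, exp (-a * ‖ξ i‖ ^ 2)) := by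
    field_simp
  rw [e1, e2]
  exact mul_le_mul_of_nonneg_left hsum (by positivity)

theorem norm_sub_le_of_cone {V : Type*} [NormedAddCommGroup V] [InnerProductSpace ℝ V]
    {e x x' : V} {c : ℝ} (he : ‖e‖ = 1) (hc : 0 < c) (hc1 : c ≤ 1)
    (hx : c * ‖x‖ ≤ inner ℝ e x) (hx' : c * ‖x'‖ ≤ inner ℝ e x')
    (hxx : 2 / c * |‖x‖ - ‖x'‖| ≤ ‖x - x'‖) :
    ‖x - x'‖ ≤ 4 / c * ‖(x - inner ℝ e x • e) - (x' - inner ℝ e x' • e)‖ := by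
  set τ := inner ℝ e (x - x') with hτ
  set p := (x - inner ℝ e x • e) - (x' - inner ℝ e x' • e) with hp
  have hdec : x - x' = τ • e + p := by
    rw [hτ, hp, inner_sub_right, sub_smul]; abel
  have hsq : ‖x‖ ^ 2 - ‖x'‖ ^ 2 = τ * (inner ℝ e x + inner ℝ e x') + inner ℝ p (x + x') := by
    have h1 : inner ℝ (x - x') (x + x') = ‖x‖ ^ 2 - ‖x'‖ ^ 2 := by
      rw [inner_sub_left, inner_add_right, inner_add_right, real_inner_self_eq_norm_sq,
        real_inner_self_eq_norm_sq, real_inner_comm x x']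
      ring
    rw [← h1, hdec, inner_add_left, real_inner_smul_left, inner_add_right e]
  have hin : |inner ℝ p (x + x')| ≤ ‖p‖ * (‖x‖ + ‖x'‖) :=
    (abs_real_inner_le_norm _ _).trans (by gcongr; exact norm_add_le _ _)
  have hΔ : ‖x - x'‖ ≤ |τ| + ‖p‖ := by
    rw [hdec]
    refine (norm_add_le _ _).trans ?_
    rw [norm_smul, he, mul_one, Real.norm_eq_abs]
  set S := ‖x‖ + ‖x'‖ with hS
  rcases (show 0 ≤ S by positivity).eq_or_lt with h0 | hSpos
  · have hx0 : ‖x‖ = 0 := by linarith [norm_nonneg x, norm_nonneg x']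
    have hx0' : ‖x'‖ = 0 := by linarith [norm_nonneg x, norm_nonneg x']
    rw [norm_eq_zero] at hx0 hx0'
    rw [hx0, hx0', sub_zero, norm_zero]
    positivity
  have key : c * |τ| ≤ |‖x‖ - ‖x'‖| + ‖p‖ := by
    have h2 : |τ| * (inner ℝ e x + inner ℝ e x') ≤ |‖x‖ - ‖x'‖| * S + ‖p‖ * S := by
      have h3 : τ * (inner ℝ e x + inner ℝ e x') = (‖x‖ - ‖x'‖) * S - inner ℝ p (x + x') := by
        rw [hS]; linarith [hsq]
      have h4 : 0 ≤ inner ℝ e x + inner ℝ e x' := by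
        have := mul_nonneg hc.le hSpos.le
        rw [hS] at this; linarith
      calc |τ| * (inner ℝ e x + inner ℝ e x') = |τ * (inner ℝ e x + inner ℝ e x')| := by
            rw [abs_mul, abs_of_nonneg h4]
        _ ≤ |(‖x‖ - ‖x'‖) * S| + |inner ℝ p (x + x')| := by rw [h3]; exact abs_sub _ _
        _ ≤ _ := by rw [abs_mul, abs_of_pos hSpos]; linarith
    have h5 : |τ| * (c * S) ≤ |τ| * (inner ℝ e x + inner ℝ e x') := by
      refine mul_le_mul_of_nonneg_left ?_ (abs_nonneg _)
      rw [hS]; linarith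
    refine le_of_mul_le_mul_right ?_ hSpos
    nlinarith
  have k2 : |‖x‖ - ‖x'‖| ≤ c / 2 * ‖x - x'‖ := by
    have := mul_le_mul_of_nonneg_left hxx (show 0 ≤ c / 2 by positivity)
    have e : c / 2 * (2 / c * |‖x‖ - ‖x'‖|) = |‖x‖ - ‖x'‖| := by field_simp
    linarith
  have k3 : c * ‖x - x'‖ ≤ 4 * ‖p‖ := by
    have := mul_le_mul_of_nonneg_left hΔ hc.le
    nlinarith [norm_nonneg p]
  rw [div_mul_eq_mul_div, le_div_iff₀ hc]
  linarith

theorem exists_one_add_pow_mul_exp_neg_le (k : ℕ) {c : ℝ} (hc : 0 < c) :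
    ∃ C : ℝ, 0 < C ∧ ∀ t : ℝ, 0 ≤ t → (1 + t) ^ k * exp (-c * t) ≤ C := by
  refine ⟨k.factorial * exp c / c ^ k, by positivity, fun t ht => ?_⟩
  have h := Real.pow_div_factorial_le_exp (c * (1 + t)) (by positivity) k
  rw [div_le_iff₀ (by positivity), mul_pow] at h
  rw [le_div_iff₀ (by positivity)]
  have e : exp c = exp (c * (1 + t)) * exp (-c * t) := by rw [← exp_add]; congr 1; ring
  rw [e]
  have := mul_le_mul_of_nonneg_right h (exp_pos (-c * t)).le
  linarith

theorem exists_one_add_pow_mul_exp_neg_sq_le (k : ℕ) {c : ℝ} (hc : 0 < c) :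
    ∃ C : ℝ, 0 < C ∧ ∀ t : ℝ, 0 ≤ t → (1 + t) ^ k * exp (-c * t ^ 2) ≤ C := by
  obtain ⟨C, hC, h⟩ := exists_one_add_pow_mul_exp_neg_le k hc
  refine ⟨exp c * C, by positivity, fun t ht => ?_⟩
  have h1 : exp (-c * t ^ 2) ≤ exp c * exp (-c * t) := by
    rw [← exp_add, exp_le_exp]
    nlinarith [sq_nonneg (t - 1)]
  calc (1 + t) ^ k * exp (-c * t ^ 2) ≤ (1 + t) ^ k * (exp c * exp (-c * t)) := by gcongr
    _ = exp c * ((1 + t) ^ k * exp (-c * t)) := by ring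
    _ ≤ exp c * C := by gcongr; exact h t ht

theorem sum_exp_neg_sq_le_of_cone (m : ℕ) {c κ : ℝ} (A : ℝ) (hc : 0 < c) (hc1 : c ≤ 1)
    (hκ : 0 < κ) :
    ∃ C : ℝ, 0 < C ∧ ∀ (X : Finset (EuclideanSpace ℝ (Fin (m + 1))))
      (e : EuclideanSpace ℝ (Fin (m + 1))) (ρ a : ℝ), ‖e‖ = 1 → 0 < ρ → 0 < a → a ≤ A * ρ ^ 2 →
      (∀ x ∈ X, c * ‖x‖ ≤ inner ℝ e x) →
      (∀ x ∈ X, ∀ x' ∈ X, x ≠ x' → 2 / c * |‖x‖ - ‖x'‖| ≤ ‖x - x'‖ ∧ κ ≤ ρ * ‖x - x'‖) →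
      ∑ x ∈ X, exp (-a * ‖x - inner ℝ e x • e‖ ^ 2) ≤ C * (ρ * (√a)⁻¹) ^ m := by
  obtain ⟨C, hC, H⟩ := sum_exp_neg_sq_le_of_separated m (A * (c * κ / 4) ^ 2)
  refine ⟨C * (4 / (c * κ)) ^ m, by positivity, ?_⟩
  intro X e ρ a he hρ ha haA hcone hsep
  have : Fact (Module.finrank ℝ (EuclideanSpace ℝ (Fin (m + 1))) = m + 1) :=
    ⟨finrank_euclideanSpace_fin⟩
  have he0 : e ≠ 0 := by rintro rfl; simp at he
  let b := (OrthonormalBasis.fromOrthogonalSpanSingleton (𝕜 := ℝ) m he0).repr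
  have hmem : ∀ x : EuclideanSpace ℝ (Fin (m + 1)), x - inner ℝ e x • e ∈ (ℝ ∙ e)ᗮ := by
    intro x
    rw [Submodule.mem_orthogonal_singleton_iff_inner_right, inner_sub_right,
      real_inner_smul_right, real_inner_self_eq_norm_sq, he]
    ring
  let ξ : EuclideanSpace ℝ (Fin (m + 1)) → EuclideanSpace ℝ (Fin m) :=
    fun x => b ⟨x - inner ℝ e x • e, hmem x⟩
  have hξ : ∀ x, ‖ξ x‖ = ‖x - inner ℝ e x • e‖ := by
    intro x
    simp only [ξ, LinearIsometryEquiv.norm_map]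
    rfl
  have hξ' : ∀ x x', ‖ξ x - ξ x'‖ = ‖(x - inner ℝ e x • e) - (x' - inner ℝ e x' • e)‖ := by
    intro x x'
    simp only [ξ, ← map_sub, LinearIsometryEquiv.norm_map]
    rfl
  have h := H X ξ a (c * κ / 4 / ρ) ha (by positivity) (by
      rw [div_pow, mul_div_assoc', div_le_iff₀ (by positivity)]
      nlinarith [sq_nonneg (c * κ / 4)]) (by
      intro x hx x' hx' hne
      rw [hξ']
      obtain ⟨h1, h2⟩ := hsep x hx x' hx' hne
      have h3 := norm_sub_le_of_cone he hc hc1 (hcone x hx) (hcone x' hx') h1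
      rw [div_mul_eq_mul_div, le_div_iff₀ hc] at h3
      rw [div_le_iff₀ hρ]
      nlinarith)
  simp only [hξ] at h
  have e1 : C * (4 / (c * κ)) ^ m * (ρ * (√a)⁻¹) ^ m
      = (4 / (c * κ) * ρ) ^ m * (C * (√a)⁻¹ ^ m) := by
    rw [mul_pow, mul_pow]; ring
  rw [e1]
  refine le_trans (le_of_eq ?_) (mul_le_mul_of_nonneg_left h (by positivity))
  rw [← mul_assoc, ← mul_pow]
  have : 4 / (c * κ) * ρ * (c * κ / 4 / ρ) = 1 := by field_simp
  rw [this, one_pow, one_mul]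

/-- Squared distance from `y` to the line spanned by `x`. -/
noncomputable def perpSq {V : Type*} [NormedAddCommGroup V] [InnerProductSpace ℝ V] (x y : V) : ℝ :=
  ‖y‖ ^ 2 - (inner ℝ x y) ^ 2 / ‖x‖ ^ 2

/-- The part of the global region in which `y` lies below `x`, in a narrow cone around the
segment from the origin to `x`. -/
def BelowCone {V : Type*} [NormedAddCommGroup V] (x y : V) : Prop :=
  9 / 10 * ‖x - y‖ ≤ ‖x‖ - ‖y‖ ∧ ¬ (‖x - y‖ ≤ 1 ∧ ‖x - y‖ * ‖x‖ ≤ 1)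

/-- Points which do not lie in a wide cone with vertex at one another and are not too close. -/
def Separated {V : Type*} [NormedAddCommGroup V] (L : ℝ) (X : Set V) : Prop :=
  ∀ x ∈ X, ∀ x' ∈ X, x ≠ x' → L * |‖x‖ - ‖x'‖| + 1 / (1 + ‖x‖) ≤ ‖x - x'‖

theorem BelowCone.bounds {V : Type*} [NormedAddCommGroup V] {x y : V} (h : BelowCone x y) :
    0 < ‖x - y‖ ∧ 9 / 10 ≤ ‖x‖ * ‖x - y‖ ∧ 9 / 10 ≤ ‖x‖ ∧ ‖y‖ ≤ ‖x‖ ∧ ‖x‖ ≤ ‖y‖ + ‖x - y‖ ∧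
      9 / 10 * ‖x - y‖ ≤ ‖x‖ := by
  obtain ⟨h1, h2⟩ := h
  have hy := norm_nonneg y
  have hd := norm_nonneg (x - y)
  have hx : ‖x‖ ≤ ‖y‖ + ‖x - y‖ := norm_le_norm_add_norm_sub' x y
  have hxd : 9 / 10 ≤ ‖x‖ * ‖x - y‖ := by
    by_cases h3 : ‖x - y‖ ≤ 1
    · have : ¬ (‖x - y‖ * ‖x‖ ≤ 1) := fun h => h2 ⟨h3, h⟩
      nlinarith
    · nlinarith
  have hd0 : 0 < ‖x - y‖ := by
    rcases hd.eq_or_lt with h | h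
    · rw [← h] at hxd; norm_num at hxd
    · exact h
  refine ⟨hd0, hxd, ?_, by linarith, hx, by linarith⟩
  nlinarith [norm_nonneg x]

theorem BelowCone.norm_sub_le {V : Type*} [NormedAddCommGroup V] {L : ℝ} (hL : 4 ≤ L) {X : Set V}
    (hX : Separated L X) {x x' y : V} (hx : x ∈ X) (hx' : x' ∈ X) (h : BelowCone x y)
    (h' : BelowCone x' y) : ‖x - y‖ ≤ 2 * ‖x' - y‖ := by
  by_contra hlt
  push Not at hlt
  have hne : x ≠ x' := by
    rintro rfl
    linarith [h.bounds.1]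
  have h1 := hX x hx x' hx' hne
  have h2 : 0 < 1 / (1 + ‖x‖) := by positivity
  have h3 : ‖x - x'‖ ≤ ‖x - y‖ + ‖x' - y‖ := by
    rw [← sub_sub_sub_cancel_right x x' y]
    exact _root_.norm_sub_le _ _
  have h4 := h.1
  have h5 := h'.bounds.2.2.2.2.1
  have h6 := le_abs_self (‖x‖ - ‖x'‖)
  nlinarith [h'.bounds.1, abs_nonneg (‖x‖ - ‖x'‖)]

theorem norm_sub_inner_smul_sq {V : Type*} [NormedAddCommGroup V] [InnerProductSpace ℝ V]
    {e : V} (he : ‖e‖ = 1) (x : V) :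
    ‖x - inner ℝ e x • e‖ ^ 2 = ‖x‖ ^ 2 - inner ℝ e x ^ 2 := by
  rw [norm_sub_sq_real, norm_smul, he, real_inner_smul_right, real_inner_comm, mul_one,
    Real.norm_eq_abs, sq_abs]
  ring

theorem perpSq_eq {V : Type*} [NormedAddCommGroup V] [InnerProductSpace ℝ V]
    {e x y : V} {r : ℝ} (he : ‖e‖ = 1) (hx : x ≠ 0) (hy : y = r • e) :
    perpSq x y = r ^ 2 / ‖x‖ ^ 2 * ‖x - inner ℝ e x • e‖ ^ 2 := by
  have : ‖x‖ ≠ 0 := norm_ne_zero_iff.2 hx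
  rw [norm_sub_inner_smul_sq he, perpSq, hy, norm_smul, he, real_inner_smul_right,
    real_inner_comm, mul_one, Real.norm_eq_abs, sq_abs]
  field_simp

theorem perpSq_nonneg {V : Type*} [NormedAddCommGroup V] [InnerProductSpace ℝ V]
    (x y : V) : 0 ≤ perpSq x y := by
  rw [perpSq, sub_nonneg]
  refine div_le_of_le_mul₀ (by positivity) (by positivity) ?_
  rw [← mul_pow, ← sq_abs]
  refine pow_le_pow_left₀ (abs_nonneg _) ?_ 2
  rw [mul_comm]; exact abs_real_inner_le_norm _ _

set_option maxHeartbeats 800000 in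
theorem sum_near_le (m : ℕ) {c : ℝ} (hc : 0 < c) (hc1 : c ≤ 1 / 2) :
    ∃ C : ℝ, 0 < C ∧ ∀ (X : Finset (EuclideanSpace ℝ (Fin (m + 1))))
      (y : EuclideanSpace ℝ (Fin (m + 1))), Separated (2 / c) (X : Set (EuclideanSpace ℝ (Fin (m + 1)))) →
      (∀ x ∈ X, BelowCone x y ∧ ‖x - y‖ ≤ ‖y‖) →
      ∑ x ∈ X, (1 + ‖x‖)⁻¹ ^ (m + 1) * (‖x‖ * √(‖x‖ / ‖x - y‖) ^ m *
        exp (-(1 / 8) * perpSq x y * (‖x‖ / ‖x - y‖))) ≤ C := by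
  obtain ⟨C, hC, H⟩ := sum_exp_neg_sq_le_of_cone m (κ := 1 / 5) 1 hc (by linarith) (by norm_num)
  refine ⟨C * 16 ^ m, by positivity, ?_⟩
  intro X y hsep hX
  rcases X.eq_empty_or_nonempty with rfl | ⟨x₀, hx₀⟩
  · simp; positivity
  have hL : 4 ≤ 2 / c := by rw [le_div_iff₀ hc]; linarith
  obtain ⟨hB₀, hy₀⟩ := hX x₀ hx₀
  have hb₀ := hB₀.bounds
  set ρ := ‖y‖ with hρ
  set d₀ := ‖x₀ - y‖ with hd₀
  have hd₀pos : 0 < d₀ := hb₀.1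
  have hρpos : 0 < ρ := by linarith
  set e := ρ⁻¹ • y with he
  have he1 : ‖e‖ = 1 := by
    rw [he, norm_smul, norm_inv, norm_norm, ← hρ]; field_simp
  have hye : y = ρ • e := by rw [he, smul_inv_smul₀ hρpos.ne']
  have hx2 : ∀ x ∈ X, ‖x‖ ≤ 2 * ρ := fun x hx => by
    linarith [(hX x hx).1.bounds.2.2.2.2.1, (hX x hx).2]
  have hρd : 9 / 20 ≤ ρ * d₀ := by nlinarith [hx2 x₀ hx₀, hb₀.2.1]
  have hρ1 : 9 / 20 ≤ ρ := by linarith [hx2 x₀ hx₀, hb₀.2.2.1]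
  have key := H X e ρ (ρ / (64 * d₀)) he1 hρpos (by positivity) (by
      rw [div_le_iff₀ (by positivity)]
      nlinarith) (by
      intro x hx
      obtain ⟨hB, hdy⟩ := hX x hx
      have hb := hB.bounds
      have h1 : ‖x - y‖ ^ 2 = ‖x‖ ^ 2 - 2 * inner ℝ x y + ‖y‖ ^ 2 := norm_sub_sq_real _ _
      have h2 : inner ℝ e x = ρ⁻¹ * inner ℝ x y := by
        rw [he, real_inner_smul_left, real_inner_comm]
      rw [h2, ← div_eq_inv_mul, le_div_iff₀ hρpos]
      have h3 : ‖x - y‖ ^ 2 ≤ ρ ^ 2 := pow_le_pow_left₀ (norm_nonneg _) hdy 2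
      have h4 : ‖x‖ * ρ ≤ ‖x‖ * ‖x‖ := mul_le_mul_of_nonneg_left hb.2.2.2.1 (norm_nonneg _)
      have h5 : c * (‖x‖ * ρ) ≤ 1 / 2 * (‖x‖ * ρ) :=
        mul_le_mul_of_nonneg_right hc1 (by positivity)
      rw [← hρ] at h1
      nlinarith) (by
      intro x hx x' hx' hne
      have h1 := hsep x hx x' hx' hne
      have h2 : 0 < 1 / (1 + ‖x‖) := by positivity
      refine ⟨by linarith, ?_⟩
      have h3 : 1 / (1 + 2 * ρ) ≤ 1 / (1 + ‖x‖) := by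
        gcongr; exact hx2 x hx
      have h4 : 0 ≤ 2 / c * |‖x‖ - ‖x'‖| := by positivity
      have h5 : 1 / (1 + 2 * ρ) ≤ ‖x - x'‖ := by linarith
      rw [div_le_iff₀ (by positivity)] at h5
      nlinarith [norm_nonneg (x - x')])
  have hterm : ∀ x ∈ X, (1 + ‖x‖)⁻¹ ^ (m + 1) * (‖x‖ * √(‖x‖ / ‖x - y‖) ^ m *
        exp (-(1 / 8) * perpSq x y * (‖x‖ / ‖x - y‖))) ≤
      ρ⁻¹ ^ m * (2 * √(ρ / d₀)) ^ m *
        exp (-(ρ / (64 * d₀)) * ‖x - inner ℝ e x • e‖ ^ 2) := by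
    intro x hx
    obtain ⟨hB, hdy⟩ := hX x hx
    obtain ⟨hd, -, hx9, hyx, -, -⟩ := hB.bounds
    have hxpos : 0 < ‖x‖ := by linarith
    have hdd : ‖x - y‖ ≤ 2 * d₀ := hB.norm_sub_le hL hsep hx hx₀ hB₀
    have hdd' : d₀ ≤ 2 * ‖x - y‖ := hB₀.norm_sub_le hL hsep hx₀ hx hB
    have hxle := hx2 x hx
    have h1 : (1 + ‖x‖)⁻¹ ^ (m + 1) * ‖x‖ ≤ ρ⁻¹ ^ m := by
      rw [pow_succ, mul_assoc]
      have : (1 + ‖x‖)⁻¹ * ‖x‖ ≤ 1 := by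
        rw [inv_mul_le_iff₀ (by positivity)]; linarith
      have h' : (1 + ‖x‖)⁻¹ ≤ ρ⁻¹ := by gcongr; linarith
      calc (1 + ‖x‖)⁻¹ ^ m * ((1 + ‖x‖)⁻¹ * ‖x‖) ≤ ρ⁻¹ ^ m * 1 := by gcongr
        _ = _ := mul_one _
    have h2 : √(‖x‖ / ‖x - y‖) ≤ 2 * √(ρ / d₀) := by
      have : (2 : ℝ) = √4 := by
        rw [show (4 : ℝ) = 2 ^ 2 by norm_num, Real.sqrt_sq (by norm_num)]
      rw [this, ← Real.sqrt_mul (by norm_num)]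
      refine Real.sqrt_le_sqrt ?_
      rw [mul_div_assoc', div_le_div_iff₀ hd hd₀pos]
      have := mul_le_mul hxle hdd' hd₀pos.le (by positivity)
      linarith
    have h3 : ρ / (64 * d₀) * ‖x - inner ℝ e x • e‖ ^ 2 ≤
        1 / 8 * perpSq x y * (‖x‖ / ‖x - y‖) := by
      rw [perpSq_eq he1 (norm_pos_iff.1 hxpos) hye]
      have i1 : 1 / 4 ≤ ρ ^ 2 / ‖x‖ ^ 2 := by
        rw [le_div_iff₀ (by positivity)]
        linarith [pow_le_pow_left₀ hxpos.le hxle 2, mul_pow 2 ρ 2]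
      have i2 : ρ / (2 * d₀) ≤ ‖x‖ / ‖x - y‖ := by
        rw [div_le_div_iff₀ (by positivity) hd]
        exact mul_le_mul hyx hdd hd.le hxpos.le
      have i3 : ρ / (64 * d₀) * ‖x - inner ℝ e x • e‖ ^ 2 =
          1 / 8 * (1 / 4 * ‖x - inner ℝ e x • e‖ ^ 2) * (ρ / (2 * d₀)) := by
        field_simp; ring
      rw [i3]
      gcongr
    calc _ = (1 + ‖x‖)⁻¹ ^ (m + 1) * ‖x‖ * √(‖x‖ / ‖x - y‖) ^ m *
        exp (-(1 / 8) * perpSq x y * (‖x‖ / ‖x - y‖)) := by ring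
      _ ≤ _ := by
        gcongr ?_ * ?_ ^ m * exp ?_
        linarith
  refine (Finset.sum_le_sum hterm).trans ?_
  rw [← Finset.mul_sum]
  refine (mul_le_mul_of_nonneg_left key (by positivity)).trans (le_of_eq ?_)
  have e1 : √(ρ / (64 * d₀)) = √(ρ / d₀) / 8 := by
    rw [show ρ / (64 * d₀) = ρ / d₀ / 8 ^ 2 by field_simp; norm_num, Real.sqrt_div (by positivity),
      Real.sqrt_sq (by norm_num)]
  have hs : 0 < √(ρ / d₀) := by positivity
  rw [e1, ← mul_pow, mul_comm C, ← mul_assoc, ← mul_pow, mul_comm C]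
  congr 2
  field_simp
  norm_num

theorem exists_coord_ge (m : ℕ) (x : EuclideanSpace ℝ (Fin (m + 1))) :
    ∃ k, ‖x‖ ≤ (m + 1) * |x k| := by
  by_contra! h
  have h1 : ‖x‖ ≤ ∑ k, |x k| := by
    rw [EuclideanSpace.norm_eq]
    refine Real.sqrt_le_iff.2 ⟨by positivity, ?_⟩
    simp only [Real.norm_eq_abs]
    exact Finset.sum_sq_le_sq_sum_of_nonneg fun _ _ => abs_nonneg _
  have h2 : ∑ k : Fin (m + 1), ((m : ℝ) + 1) * |x k| < ∑ _k : Fin (m + 1), ‖x‖ :=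
    Finset.sum_lt_sum_of_nonempty Finset.univ_nonempty fun k _ => h k
  rw [← Finset.mul_sum, Finset.sum_const, Finset.card_univ, Fintype.card_fin, nsmul_eq_mul] at h2
  push_cast at h2
  have := lt_of_mul_lt_mul_left h2 (by positivity)
  linarith

set_option maxHeartbeats 800000 in
theorem sum_far_cone_le (m : ℕ) {c : ℝ} (hc : 0 < c) (hc1 : c ≤ 1 / 2) :
    ∃ C : ℝ, 0 < C ∧ ∀ (X : Finset (EuclideanSpace ℝ (Fin (m + 1))))
      (y e : EuclideanSpace ℝ (Fin (m + 1))),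
      Separated (2 / c) (X : Set (EuclideanSpace ℝ (Fin (m + 1)))) →
      (∀ x ∈ X, BelowCone x y ∧ ‖y‖ < ‖x - y‖) → ‖e‖ = 1 → (∀ x ∈ X, c * ‖x‖ ≤ inner ℝ e x) →
      ((∃ r : ℝ, y = r • e) ∨ ∀ x ∈ X, 3 / 4 * ‖y‖ ^ 2 ≤ perpSq x y) →
      ∑ x ∈ X, (1 + ‖x‖)⁻¹ ^ (m + 1) * (‖x‖⁻¹ ^ m * (1 + ‖y‖) ^ (m + 1) *
        exp (-(1 / 8) * perpSq x y)) ≤ C := by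
  obtain ⟨C, hC, H⟩ := sum_exp_neg_sq_le_of_cone m (κ := 1 / 10) 100 hc (by linarith) (by norm_num)
  obtain ⟨K, hK, HK⟩ := exists_one_add_pow_mul_exp_neg_sq_le (m + 1) (c := 3 / 32) (by norm_num)
  refine ⟨21 * 144 ^ m * exp 1 * C + 15 * 36 ^ m * K * exp 1 * C, by positivity, ?_⟩
  intro X y e hsep hX he1 hcone hor
  rcases X.eq_empty_or_nonempty with rfl | ⟨x₀, hx₀⟩
  · simp; positivity
  have hL : 4 ≤ 2 / c := by rw [le_div_iff₀ hc]; linarith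
  obtain ⟨hB₀, hy₀⟩ := hX x₀ hx₀
  have hb₀ := hB₀.bounds
  set ρ := ‖x₀ - y‖ with hρ
  have hρpos : 0 < ρ := hb₀.1
  have hfacts : ∀ x ∈ X, ρ ≤ 3 * ‖x‖ ∧ ‖x‖ ≤ 4 * ρ ∧ ‖y‖ ≤ 2 * ρ ∧ 0 < ‖x‖ := by
    intro x hx
    obtain ⟨hB, hdy⟩ := hX x hx
    obtain ⟨hd, -, hx9, hyx, hxy, hdx⟩ := hB.bounds
    have hdd : ‖x - y‖ ≤ 2 * ρ := hB.norm_sub_le hL hsep hx hx₀ hB₀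
    have hdd' : ρ ≤ 2 * ‖x - y‖ := hB₀.norm_sub_le hL hsep hx₀ hx hB
    refine ⟨?_, ?_, ?_, ?_⟩ <;> linarith
  have hρ1 : 9 / 40 ≤ ρ := by linarith [(hfacts x₀ hx₀).2.1, hb₀.2.2.1]
  have hy7 : 1 + ‖y‖ ≤ 7 * ρ := by linarith [(hfacts x₀ hx₀).2.2.1]
  have key := fun a ha haA => H X e ρ a he1 hρpos ha haA hcone (by
      intro x hx x' hx' hne
      have h1 := hsep x hx x' hx' hne
      have h2 : 0 < 1 / (1 + ‖x‖) := by positivity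
      refine ⟨by linarith, ?_⟩
      have h3 : 1 / (1 + 4 * ρ) ≤ 1 / (1 + ‖x‖) := by
        gcongr; exact (hfacts x hx).2.1
      have h4 : 0 ≤ 2 / c * |‖x‖ - ‖x'‖| := by positivity
      have h5 : 1 / (1 + 4 * ρ) ≤ ‖x - x'‖ := by linarith
      rw [div_le_iff₀ (by positivity)] at h5
      nlinarith [norm_nonneg (x - x')])
  have hξ : ∀ x ∈ X, ‖x - inner ℝ e x • e‖ ^ 2 ≤ 16 * ρ ^ 2 := by
    intro x hx
    rw [norm_sub_inner_smul_sq he1]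
    have := pow_le_pow_left₀ (norm_nonneg _) (hfacts x hx).2.1 2
    nlinarith [sq_nonneg (inner ℝ e x)]
  have hpow : ∀ x ∈ X, (1 + ‖x‖)⁻¹ ^ (m + 1) * ‖x‖⁻¹ ^ m ≤ 3 / ρ * (3 / ρ) ^ m * (3 / ρ) ^ m := by
    intro x hx
    obtain ⟨h1, -, -, h2⟩ := hfacts x hx
    have i1 : ‖x‖⁻¹ ≤ 3 / ρ := by
      rw [inv_eq_one_div, div_le_div_iff₀ h2 hρpos]; linarith
    have i2 : (1 + ‖x‖)⁻¹ ≤ 3 / ρ := by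
      refine le_trans ?_ i1
      gcongr; linarith
    rw [pow_succ']
    gcongr
  rcases hor with ⟨r, hr⟩ | hperp
  · have hrn : ‖y‖ ^ 2 = r ^ 2 := by
      rw [hr, norm_smul, he1, mul_one, Real.norm_eq_abs, sq_abs]
    have hk := key (((1 + ‖y‖) / (16 * ρ)) ^ 2) (by positivity) (by
      have : (1 + ‖y‖) / (16 * ρ) ≤ 10 * ρ := by
        rw [div_le_iff₀ (by positivity)]; nlinarith
      have := pow_le_pow_left₀ (by positivity) this 2
      linarith [mul_pow 10 ρ 2])
    rw [Real.sqrt_sq (by positivity)] at hk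
    have hterm : ∀ x ∈ X, (1 + ‖x‖)⁻¹ ^ (m + 1) * (‖x‖⁻¹ ^ m * (1 + ‖y‖) ^ (m + 1) *
        exp (-(1 / 8) * perpSq x y)) ≤
        3 / ρ * (3 / ρ) ^ m * (3 / ρ) ^ m * (1 + ‖y‖) ^ (m + 1) * exp 1 *
        exp (-((1 + ‖y‖) / (16 * ρ)) ^ 2 * ‖x - inner ℝ e x • e‖ ^ 2) := by
      intro x hx
      obtain ⟨h1, h1', -, h2⟩ := hfacts x hx
      have hexp : exp (-(1 / 8) * perpSq x y) ≤ exp 1 *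
          exp (-((1 + ‖y‖) / (16 * ρ)) ^ 2 * ‖x - inner ℝ e x • e‖ ^ 2) := by
        rw [← exp_add, exp_le_exp, perpSq_eq he1 (norm_pos_iff.1 h2) hr, ← hrn]
        set q := ‖x - inner ℝ e x • e‖ ^ 2 with hq
        have hq0 : 0 ≤ q := by positivity
        have i1 : ‖y‖ ^ 2 / (16 * ρ ^ 2) * q ≤ ‖y‖ ^ 2 / ‖x‖ ^ 2 * q := by
          gcongr
          have := pow_le_pow_left₀ h2.le h1' 2
          linarith [mul_pow 4 ρ 2]
        have i2 : ((1 + ‖y‖) / (16 * ρ)) ^ 2 * q ≤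
            1 / 8 * (‖y‖ ^ 2 / (16 * ρ ^ 2) * q) + 1 / 8 * (q / (16 * ρ ^ 2)) := by
          have : 1 / 8 * (‖y‖ ^ 2 / (16 * ρ ^ 2) * q) + 1 / 8 * (q / (16 * ρ ^ 2)) -
            ((1 + ‖y‖) / (16 * ρ)) ^ 2 * q = q * (1 - ‖y‖) ^ 2 / (256 * ρ ^ 2) := by
            field_simp; ring
          have : 0 ≤ q * (1 - ‖y‖) ^ 2 / (256 * ρ ^ 2) := by positivity
          linarith
        have i3 : q / (16 * ρ ^ 2) ≤ 1 := by
          rw [div_le_one (by positivity)]; exact hξ x hx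
        linarith
      calc _ = (1 + ‖x‖)⁻¹ ^ (m + 1) * ‖x‖⁻¹ ^ m * (1 + ‖y‖) ^ (m + 1) *
            exp (-(1 / 8) * perpSq x y) := by ring
        _ ≤ 3 / ρ * (3 / ρ) ^ m * (3 / ρ) ^ m * (1 + ‖y‖) ^ (m + 1) * (exp 1 *
          exp (-((1 + ‖y‖) / (16 * ρ)) ^ 2 * ‖x - inner ℝ e x • e‖ ^ 2)) := by
            gcongr ?_ * (1 + ‖y‖) ^ (m + 1) * ?_
            exact hpow x hx
        _ = _ := by ring
    refine (Finset.sum_le_sum hterm).trans ?_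
    rw [← Finset.mul_sum]
    refine (mul_le_mul_of_nonneg_left hk (by positivity)).trans ?_
    have hy1 : 0 < 1 + ‖y‖ := by positivity
    have e1 : 3 / ρ * (3 / ρ) ^ m * (3 / ρ) ^ m * (1 + ‖y‖) ^ (m + 1) * exp 1 *
        (C * (ρ * ((1 + ‖y‖) / (16 * ρ))⁻¹) ^ m) =
        (3 / ρ * (1 + ‖y‖)) * exp 1 * C *
          (3 / ρ * (3 / ρ) * (1 + ‖y‖) * (ρ * ((1 + ‖y‖) / (16 * ρ))⁻¹)) ^ m := by
      rw [mul_pow (3 / ρ * (3 / ρ) * (1 + ‖y‖)), mul_pow (3 / ρ * (3 / ρ)),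
        mul_pow (3 / ρ) (3 / ρ), pow_succ]
      ring
    have e2 : 3 / ρ * (3 / ρ) * (1 + ‖y‖) * (ρ * ((1 + ‖y‖) / (16 * ρ))⁻¹) = 144 := by
      field_simp; norm_num
    have e3 : 3 / ρ * (1 + ‖y‖) ≤ 21 := by
      rw [div_mul_eq_mul_div, div_le_iff₀ hρpos]; linarith
    rw [e1, e2]
    have : 3 / ρ * (1 + ‖y‖) * exp 1 * C * 144 ^ m ≤ 21 * exp 1 * C * 144 ^ m := by gcongr
    have : 0 ≤ 15 * 36 ^ m * K * exp 1 * C := by positivity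
    linarith
  · have hk := key ((1 / (4 * ρ)) ^ 2) (by positivity) (by
      have : 1 / (4 * ρ) ≤ 10 * ρ := by
        rw [div_le_iff₀ (by positivity)]; nlinarith
      have := pow_le_pow_left₀ (by positivity) this 2
      linarith [mul_pow 10 ρ 2])
    rw [Real.sqrt_sq (by positivity)] at hk
    have hterm : ∀ x ∈ X, (1 + ‖x‖)⁻¹ ^ (m + 1) * (‖x‖⁻¹ ^ m * (1 + ‖y‖) ^ (m + 1) *
        exp (-(1 / 8) * perpSq x y)) ≤
        3 / ρ * (3 / ρ) ^ m * (3 / ρ) ^ m * K * exp 1 *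
        exp (-(1 / (4 * ρ)) ^ 2 * ‖x - inner ℝ e x • e‖ ^ 2) := by
      intro x hx
      have hK1 : (1 + ‖y‖) ^ (m + 1) * exp (-(1 / 8) * perpSq x y) ≤ K := by
        refine le_trans ?_ (HK ‖y‖ (norm_nonneg _))
        refine mul_le_mul_of_nonneg_left (exp_le_exp.2 ?_) (by positivity)
        linarith [hperp x hx]
      have hone : 1 ≤ exp 1 * exp (-(1 / (4 * ρ)) ^ 2 * ‖x - inner ℝ e x • e‖ ^ 2) := by
        rw [← exp_add]
        refine one_le_exp ?_
        have : (1 / (4 * ρ)) ^ 2 * ‖x - inner ℝ e x • e‖ ^ 2 ≤ 1 := by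
          rw [div_pow, one_pow, div_mul_eq_mul_div, one_mul, div_le_one (by positivity)]
          linarith [hξ x hx, mul_pow 4 ρ 2]
        linarith
      calc _ = (1 + ‖x‖)⁻¹ ^ (m + 1) * ‖x‖⁻¹ ^ m * ((1 + ‖y‖) ^ (m + 1) *
            exp (-(1 / 8) * perpSq x y)) * 1 := by ring
        _ ≤ 3 / ρ * (3 / ρ) ^ m * (3 / ρ) ^ m * K * (exp 1 *
          exp (-(1 / (4 * ρ)) ^ 2 * ‖x - inner ℝ e x • e‖ ^ 2)) := by
            gcongr ?_ * ?_ * ?_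
            exact hpow x hx
        _ = _ := by ring
    refine (Finset.sum_le_sum hterm).trans ?_
    rw [← Finset.mul_sum]
    refine (mul_le_mul_of_nonneg_left hk (by positivity)).trans ?_
    have e1 : 3 / ρ * (3 / ρ) ^ m * (3 / ρ) ^ m * K * exp 1 *
        (C * (ρ * (1 / (4 * ρ))⁻¹) ^ m) =
        3 / ρ * K * exp 1 * C * (3 / ρ * (3 / ρ) * (ρ * (1 / (4 * ρ))⁻¹)) ^ m := by
      rw [mul_pow (3 / ρ * (3 / ρ)), mul_pow (3 / ρ) (3 / ρ)]
      ring
    have e2 : 3 / ρ * (3 / ρ) * (ρ * (1 / (4 * ρ))⁻¹) = 36 := by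
      field_simp; norm_num
    have e3 : 3 / ρ ≤ 15 := by
      rw [div_le_iff₀ hρpos]; linarith
    rw [e1, e2]
    have : 3 / ρ * K * exp 1 * C * 36 ^ m ≤ 15 * K * exp 1 * C * 36 ^ m := by gcongr
    have : 0 ≤ 21 * 144 ^ m * exp 1 * C := by positivity
    linarith

theorem Separated.mono {V : Type*} [NormedAddCommGroup V] {L : ℝ} {X Y : Set V}
    (h : Separated L Y) (hXY : X ⊆ Y) : Separated L X :=
  fun x hx x' hx' hne => h x (hXY hx) x' (hXY hx') hne

theorem sum_far_le (m : ℕ) {c : ℝ} (hc : 0 < c) (hc1 : c ≤ 1 / 2) (hcm : c * (m + 1) ≤ 1) :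
    ∃ C : ℝ, 0 < C ∧ ∀ (X : Finset (EuclideanSpace ℝ (Fin (m + 1))))
      (y : EuclideanSpace ℝ (Fin (m + 1))),
      Separated (2 / c) (X : Set (EuclideanSpace ℝ (Fin (m + 1)))) →
      (∀ x ∈ X, BelowCone x y ∧ ‖y‖ < ‖x - y‖) →
      ∑ x ∈ X, (1 + ‖x‖)⁻¹ ^ (m + 1) * (‖x‖⁻¹ ^ m * (1 + ‖y‖) ^ (m + 1) *
        exp (-(1 / 8) * perpSq x y)) ≤ C := by
  classical
  obtain ⟨C, hC, H⟩ := sum_far_cone_le m hc hc1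
  let J := Bool ⊕ (Fin (m + 1) × Bool)
  refine ⟨(Fintype.card J : ℝ) * C, mul_pos (by exact_mod_cast Fintype.card_pos) hC, ?_⟩
  intro X y hsep hX
  let sgn : Bool → ℝ := fun b => if b then 1 else -1
  let e : J → EuclideanSpace ℝ (Fin (m + 1)) := fun j => match j with
    | Sum.inl b => (sgn b * ‖y‖⁻¹) • y
    | Sum.inr (k, b) => EuclideanSpace.single k (sgn b)
  let good : J → EuclideanSpace ℝ (Fin (m + 1)) → Prop := fun j x =>
    ‖e j‖ = 1 ∧ c * ‖x‖ ≤ inner ℝ (e j) x ∧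
      ((∃ r : ℝ, y = r • e j) ∨ 3 / 4 * ‖y‖ ^ 2 ≤ perpSq x y)
  have hgood : ∀ x ∈ X, ∃ j, good j x := by
    intro x hx
    have hxpos : 0 < ‖x‖ := by linarith [(hX x hx).1.bounds.2.2.1]
    by_cases hcase : y ≠ 0 ∧ 1 / 2 * (‖x‖ * ‖y‖) ≤ |inner ℝ y x|
    · obtain ⟨hy, hxy⟩ := hcase
      have hy0 : 0 < ‖y‖ := norm_pos_iff.2 hy
      have hs : ∃ b, |inner ℝ y x| = sgn b * inner ℝ y x ∧ sgn b * sgn b = 1 := by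
        rcases le_total 0 (inner ℝ y x) with h | h
        · exact ⟨true, by simp [sgn, abs_of_nonneg h], by simp [sgn]⟩
        · exact ⟨false, by simp [sgn, abs_of_nonpos h], by simp [sgn]⟩
      obtain ⟨b, hb, hb2⟩ := hs
      refine ⟨Sum.inl b, ?_, ?_, Or.inl ⟨sgn b * ‖y‖, ?_⟩⟩
      · simp only [e, norm_smul, norm_mul, norm_inv, norm_norm]
        have : ‖sgn b‖ = 1 := by cases b <;> simp [sgn]
        rw [this]; field_simp
      · simp only [e]
        rw [real_inner_smul_left, mul_right_comm, ← hb, ← div_eq_mul_inv, le_div_iff₀ hy0]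
        refine le_trans ?_ hxy
        rw [mul_assoc]
        exact mul_le_mul_of_nonneg_right hc1 (by positivity)
      · simp only [e]
        rw [smul_smul]
        have : sgn b * ‖y‖ * (sgn b * ‖y‖⁻¹) = 1 := by
          rw [mul_mul_mul_comm, hb2, mul_inv_cancel₀ hy0.ne', one_mul]
        rw [this, one_smul]
    · obtain ⟨k, hk⟩ := exists_coord_ge m x
      have hs : ∃ b, |x k| = sgn b * x k ∧ ‖sgn b‖ = 1 := by
        rcases le_total 0 (x k) with h | h
        · exact ⟨true, by simp [sgn, abs_of_nonneg h], by simp [sgn]⟩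
        · exact ⟨false, by simp [sgn, abs_of_nonpos h], by simp [sgn]⟩
      obtain ⟨b, hb, hb2⟩ := hs
      refine ⟨Sum.inr (k, b), ?_, ?_, Or.inr ?_⟩
      · simp only [e, PiLp.norm_single, hb2]
      · simp only [e, EuclideanSpace.inner_single_left]
        have : (starRingEnd ℝ) (sgn b) * x k = |x k| := by rw [hb]; simp
        rw [this]
        calc c * ‖x‖ ≤ c * ((m + 1) * |x k|) := by gcongr
          _ = c * (m + 1) * |x k| := by ring
          _ ≤ 1 * |x k| := by gcongr
          _ = _ := one_mul _
      · rw [not_and_or, not_not, not_le] at hcase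
        rcases hcase with rfl | h
        · simp [perpSq]
        · rw [perpSq]
          have : inner ℝ x y ^ 2 / ‖x‖ ^ 2 ≤ 1 / 4 * ‖y‖ ^ 2 := by
            rw [div_le_iff₀ (by positivity), real_inner_comm, ← sq_abs]
            have := pow_le_pow_left₀ (abs_nonneg _) h.le 2
            linarith [show (1 / 2 * (‖x‖ * ‖y‖)) ^ 2 = 1 / 4 * ‖y‖ ^ 2 * ‖x‖ ^ 2 by ring]
          linarith
  have hgood' : ∀ x, ∃ j, x ∈ X → good j x := fun x => by
    by_cases hx : x ∈ X
    · obtain ⟨j, hj⟩ := hgood x hx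
      exact ⟨j, fun _ => hj⟩
    · exact ⟨Sum.inl true, fun h => absurd h hx⟩
  choose φ hφ using hgood'
  rw [← Finset.sum_fiberwise X φ]
  calc _ ≤ ∑ _j : J, C := ?_
    _ = _ := by rw [Finset.sum_const, nsmul_eq_mul]; rfl
  refine Finset.sum_le_sum fun j _ => ?_
  set Y := X.filter fun x => φ x = j with hY
  rcases Y.eq_empty_or_nonempty with h0 | ⟨x₁, hx₁⟩
  · rw [h0]; simpa using hC.le
  have hYX : ∀ x ∈ Y, x ∈ X ∧ good j x := by
    intro x hx
    rw [hY, Finset.mem_filter] at hx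
    exact ⟨hx.1, hx.2 ▸ hφ x hx.1⟩
  refine H Y y (e j) (hsep.mono fun x hx => Finset.mem_coe.2 (hYX x (Finset.mem_coe.1 hx)).1) (fun x hx => hX x (hYX x hx).1)
    (hYX x₁ hx₁).2.1 (fun x hx => (hYX x hx).2.2.1) ?_
  by_cases h : ∃ r : ℝ, y = r • e j
  · exact Or.inl h
  · exact Or.inr fun x hx => ((hYX x hx).2.2.2.resolve_left h)

open scoped Classical in
/-- Majorant of the kernel in the region `BelowCone`. -/
noncomputable def coneKernel {V : Type*} [NormedAddCommGroup V] [InnerProductSpace ℝ V] (m : ℕ)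
    (x y : V) : ℝ :=
  if BelowCone x y then
    if ‖x - y‖ ≤ ‖y‖ then
      ‖x‖ * √(‖x‖ / ‖x - y‖) ^ m * exp (-(1 / 8) * perpSq x y * (‖x‖ / ‖x - y‖))
    else ‖x‖⁻¹ ^ m * (1 + ‖y‖) ^ (m + 1) * exp (-(1 / 8) * perpSq x y)
  else 0

theorem coneKernel_nonneg {V : Type*} [NormedAddCommGroup V] [InnerProductSpace ℝ V] (m : ℕ)
    (x y : V) : 0 ≤ coneKernel m x y := by
  unfold coneKernel
  split_ifs <;> positivity

theorem sum_coneKernel_le (m : ℕ) {c : ℝ} (hc : 0 < c) (hc1 : c ≤ 1 / 2) (hcm : c * (m + 1) ≤ 1) :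
    ∃ C : ℝ, 0 < C ∧ ∀ (X : Finset (EuclideanSpace ℝ (Fin (m + 1))))
      (y : EuclideanSpace ℝ (Fin (m + 1))),
      Separated (2 / c) (X : Set (EuclideanSpace ℝ (Fin (m + 1)))) →
      ∑ x ∈ X, (1 + ‖x‖)⁻¹ ^ (m + 1) * coneKernel m x y ≤ C := by
  classical
  obtain ⟨C₁, hC₁, H₁⟩ := sum_near_le m hc hc1
  obtain ⟨C₂, hC₂, H₂⟩ := sum_far_le m hc hc1 hcm
  refine ⟨C₁ + C₂, by positivity, fun X y hX => ?_⟩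
  have h₁ := H₁ (X.filter fun x => BelowCone x y ∧ ‖x - y‖ ≤ ‖y‖) y (hX.mono fun x hx =>
      Finset.mem_coe.2 (Finset.mem_filter.1 (Finset.mem_coe.1 hx)).1)
    (fun x hx => (Finset.mem_filter.1 hx).2)
  have h₂ := H₂ (X.filter fun x => BelowCone x y ∧ ‖y‖ < ‖x - y‖) y (hX.mono fun x hx =>
      Finset.mem_coe.2 (Finset.mem_filter.1 (Finset.mem_coe.1 hx)).1)
    (fun x hx => (Finset.mem_filter.1 hx).2)
  refine le_trans (le_of_eq ?_) (add_le_add h₁ h₂)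
  rw [Finset.sum_filter, Finset.sum_filter, ← Finset.sum_add_distrib]
  refine Finset.sum_congr rfl fun x _ => ?_
  unfold coneKernel
  by_cases h : BelowCone x y
  · by_cases h' : ‖x - y‖ ≤ ‖y‖
    · simp [h, h', not_lt.2 h']
    · simp [h, h', not_le.1 h']
  · simp [h]

/-- Majorant of the time-weighted derivative of the kernel, in the variable `r = e⁻ᵗ`. -/
noncomputable def mehlerMajorant {V : Type*} [NormedAddCommGroup V] [InnerProductSpace ℝ V] (m : ℕ)
    (r : ℝ) (x y : V) : ℝ :=
  r ^ m * (√(1 - r ^ 2))⁻¹ ^ (m + 1) * (1 + r * ‖x‖ * √(1 - r ^ 2)) *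
    exp (-(‖y - r • x‖ ^ 2 / (1 - r ^ 2)) / 2)

theorem perpSq_le {V : Type*} [NormedAddCommGroup V] [InnerProductSpace ℝ V] {x : V} (hx : x ≠ 0)
    (y : V) (r : ℝ) : perpSq x y ≤ ‖y - r • x‖ ^ 2 := by
  have hx0 : 0 < ‖x‖ := norm_pos_iff.2 hx
  rw [perpSq, norm_sub_sq_real, norm_smul, mul_pow, real_inner_smul_right, real_inner_comm,
    Real.norm_eq_abs, sq_abs]
  have e : ‖y‖ ^ 2 - 2 * (r * inner ℝ y x) + r ^ 2 * ‖x‖ ^ 2 -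
      (‖y‖ ^ 2 - inner ℝ y x ^ 2 / ‖x‖ ^ 2) = (inner ℝ y x / ‖x‖ - r * ‖x‖) ^ 2 := by
    field_simp; ring
  rw [real_inner_comm x y] at *
  nlinarith [sq_nonneg (inner ℝ x y / ‖x‖ - r * ‖x‖)]

set_option maxHeartbeats 800000 in
theorem majorant_offCone_le (m : ℕ) :
    ∃ C : ℝ, 0 < C ∧ ∀ r s R d w Y : ℝ, 0 < r → r < 1 → s = 1 - r ^ 2 → 0 ≤ R → 0 ≤ d → 0 ≤ w →
      0 ≤ Y → d ≤ (1 - r) * R + w → (1 - r) * R ≤ d + w → Y ≤ r * R + w → d ≤ R + Y →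
      1 ≤ d * (1 + R) → 1 / 1000 * (s * R * d) ≤ w ^ 2 →
      r ^ m * (√s)⁻¹ ^ (m + 1) * (1 + r * R * √s) * exp (-(w ^ 2 / s) / 2) ≤
        C * ((1 + R) ^ (m + 1) * exp (-(1 / 12000) * ((1 + Y) * d))) := by
  obtain ⟨K₁, hK₁, H₁⟩ := exists_one_add_pow_mul_exp_neg_sq_le (m + 1) (c := 1 / 32) (by norm_num)
  obtain ⟨K₂, hK₂, H₂⟩ := exists_one_add_pow_mul_exp_neg_sq_le 1 (c := 1 / 32000) (by norm_num)
  refine ⟨(K₁ + 2 ^ (m + 1)) * K₂ * exp 1, by positivity, ?_⟩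
  intro r s R d w Y hr hr1 hs hR hd hw hY h1 h2 h3 h4 h5 h6
  have hs0 : 0 < s := by nlinarith
  have hs1 : s ≤ 1 := by nlinarith
  have hσs : 1 - r ≤ s := by nlinarith
  have hsσ : s ≤ 2 * (1 - r) := by nlinarith
  set U := w ^ 2 / s with hU
  have hU0 : 0 ≤ U := by positivity
  have hUs : U * s = w ^ 2 := by rw [hU]; field_simp
  set q := √s with hq
  have hq0 : 0 < q := Real.sqrt_pos.2 hs0
  have hq2 : q ^ 2 = s := Real.sq_sqrt hs0.le
  set a := (1 - r) * R with ha
  have ha0 : 0 ≤ a := mul_nonneg (by linarith) hR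
  have hsa : s * R ≤ 2 * a := by rw [ha]; nlinarith
  have hsR0 : 0 ≤ s * R := by positivity
  have i1 : 1 / 4000 * (R * q) ^ 2 ≤ U := by
    rw [hU, le_div_iff₀ hs0, mul_pow, hq2]
    rcases le_total d (a / 2) with h | h
    · have : (s * R) / 4 ≤ w := by linarith
      have := pow_le_pow_left₀ (by positivity) this 2
      nlinarith
    · have : s * R * (s * R / 4) ≤ s * R * d := by
        refine mul_le_mul_of_nonneg_left ?_ hsR0
        linarith
      nlinarith
  have i2 : (q)⁻¹ ^ (m + 1) * exp (-U / 8) ≤ (K₁ + 2 ^ (m + 1)) * (1 + R) ^ (m + 1) := by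
    set p := (q * (1 + R))⁻¹ with hp
    have hp0 : 0 < p := by positivity
    have e : q⁻¹ = p * (1 + R) := by rw [hp]; field_simp
    rw [e, mul_pow, mul_right_comm]
    refine mul_le_mul_of_nonneg_right ?_ (by positivity)
    have hd1 : 1 / (1 + R) ≤ d := by
      rw [div_le_iff₀ (by positivity)]; exact h5
    rcases le_total (2 * a) d with h | h
    · have hw2 : 1 / (1 + R) / 2 ≤ w := by linarith
      have hw3 := pow_le_pow_left₀ (by positivity) hw2 2
      have hpU : p ^ 2 / 4 ≤ U := by
        rw [hU, le_div_iff₀ hs0, ← hq2]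
        have : p ^ 2 / 4 * q ^ 2 = (1 / (1 + R) / 2) ^ 2 := by
          rw [hp]; field_simp; norm_num
        rw [this]; exact hw3
      calc p ^ (m + 1) * exp (-U / 8) ≤ (1 + p) ^ (m + 1) * exp (-(1 / 32) * p ^ 2) := by
            gcongr
            · linarith
            · linarith
        _ ≤ K₁ := H₁ p hp0.le
        _ ≤ _ := by
          have : (0 : ℝ) < 2 ^ (m + 1) := by positivity
          linarith
    · have hp2 : p ≤ 2 := by
        rw [hp, inv_le_comm₀ (by positivity) (by norm_num)]
        have k1 : 1 / (1 + R) ≤ 2 * ((1 - r) * R) := by linarith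
        rw [div_le_iff₀ (by positivity)] at k1
        have k2 : (1 - r) * R * (1 + R) ≤ s * R * (1 + R) := by gcongr
        have k3 : s * R * (1 + R) ≤ s * (1 + R) * (1 + R) := by gcongr; linarith
        have k4 : (1 / 2 : ℝ) ≤ (q * (1 + R)) ^ 2 := by
          rw [mul_pow, hq2]; nlinarith
        refine (sq_le_sq₀ (by norm_num) (by positivity)).1 (le_trans (by norm_num) k4)
      calc p ^ (m + 1) * exp (-U / 8) ≤ 2 ^ (m + 1) * 1 := by
            gcongr
            rw [exp_le_one_iff]; linarith
        _ ≤ _ := by linarith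
  have i3 : (1 + r * R * q) * exp (-U / 8) ≤ K₂ := by
    have := H₂ (R * q) (by positivity)
    rw [pow_one] at this
    refine le_trans ?_ this
    gcongr
    · exact mul_le_of_le_one_left hR hr1.le
    · linarith
  have i4 : exp (-U / 4) ≤ exp 1 * exp (-(1 / 12000) * ((1 + Y) * d)) := by
    rw [← exp_add, exp_le_exp]
    have hwU : w ^ 2 ≤ U := by
      rw [← hUs]; exact mul_le_of_le_one_right hU0 hs1
    have hRd : R * d ≤ 1000 * U := by
      have : R * d * s ≤ 1000 * U * s := by rw [mul_assoc 1000, hUs]; linarith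
      exact le_of_mul_le_mul_right this hs0
    have : (1 + Y) * d ≤ 9 + 3000 * U := by
      rcases le_total (2 * R) Y with h | h
      · have k0 : r * R ≤ R := mul_le_of_le_one_left hR hr1.le
        have k1 : Y / 2 ≤ w := by linarith
        have k2 := pow_le_pow_left₀ (by positivity) k1 2
        have k3 : d ≤ 3 / 2 * Y := by linarith
        have k4 : (1 + Y) * d ≤ (1 + Y) * (3 / 2 * Y) := by gcongr
        have k5 : (1 + Y) * (3 / 2 * Y) ≤ 1 + 3 * Y ^ 2 := by nlinarith [sq_nonneg (Y - 1)]
        have k6 : (Y / 2) ^ 2 = Y ^ 2 / 4 := by ring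
        linarith
      · rcases le_total 1 R with h' | h'
        · have : (1 + Y) * d ≤ (3 * R) * d := by gcongr; linarith
          linarith
        · have : (1 + Y) * d ≤ (1 + 2) * 3 := by gcongr <;> linarith
          linarith
    linarith
  calc r ^ m * q⁻¹ ^ (m + 1) * (1 + r * R * q) * exp (-U / 2)
      ≤ 1 * q⁻¹ ^ (m + 1) * (1 + r * R * q) * exp (-U / 2) := by
        gcongr
        exact pow_le_one₀ hr.le hr1.le
    _ = (q⁻¹ ^ (m + 1) * exp (-U / 8)) * ((1 + r * R * q) * exp (-U / 8)) * exp (-U / 4) := by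
        have : exp (-U / 2) = exp (-U / 8) * exp (-U / 8) * exp (-U / 4) := by
          rw [← exp_add, ← exp_add]; congr 1; ring
        rw [this]; ring
    _ ≤ ((K₁ + 2 ^ (m + 1)) * (1 + R) ^ (m + 1)) * K₂ *
          (exp 1 * exp (-(1 / 12000) * ((1 + Y) * d))) := by gcongr
    _ = _ := by ring

set_option maxHeartbeats 800000 in
theorem mehlerMajorant_le_coneKernel (m : ℕ) :
    ∃ C : ℝ, 0 < C ∧ ∀ {V : Type} [NormedAddCommGroup V] [InnerProductSpace ℝ V] (r : ℝ) (x y : V),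
      0 < r → r < 1 → ¬ (‖x - y‖ ≤ 1 ∧ ‖x - y‖ * ‖x‖ ≤ 1) →
      ‖y - r • x‖ ^ 2 < 1 / 1000 * ((1 - r ^ 2) * ‖x‖ * ‖x - y‖) →
      mehlerMajorant m r x y ≤ C * coneKernel m x y := by
  obtain ⟨K, hK, H⟩ := exists_one_add_pow_mul_exp_neg_sq_le (m + 1) (c := 1 / 4) (by norm_num)
  refine ⟨2 ^ (m + 1) * K + 2 ^ (m + 1) * 4, by positivity, ?_⟩
  intro V _ _ r x y hr hr1 hN hw
  set R := ‖x‖ with hR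
  set d := ‖x - y‖ with hd
  set w := ‖y - r • x‖ with hwdef
  set Y := ‖y‖ with hY
  have hR0 : 0 ≤ R := norm_nonneg _
  have hd0 : 0 ≤ d := norm_nonneg _
  have hw0 : 0 ≤ w := norm_nonneg _
  have hY0 : 0 ≤ Y := norm_nonneg _
  set a := (1 - r) * R with ha
  have ha0 : 0 ≤ a := mul_nonneg (by linarith) hR0
  have hax : ‖(1 - r) • x‖ = a := by
    rw [norm_smul, Real.norm_eq_abs, abs_of_pos (by linarith)]
  have hdec : x - y = (1 - r) • x - (y - r • x) := by rw [sub_smul, one_smul]; abel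
  have h1 : d ≤ a + w := by
    rw [hd, hdec, ← hax]; exact norm_sub_le _ _
  have h2 : a ≤ d + w := by
    have : (1 - r) • x = (x - y) + (y - r • x) := by rw [sub_smul, one_smul]; abel
    rw [← hax, this]; exact norm_add_le _ _
  have hrx : ‖r • x‖ = r * R := by rw [norm_smul, Real.norm_eq_abs, abs_of_pos hr]
  have h3 : Y ≤ r * R + w := by
    have : y = r • x + (y - r • x) := by abel
    rw [hY, ← hrx]; nth_rewrite 1 [this]; exact norm_add_le _ _
  have h4 : r * R ≤ Y + w := by
    have : r • x = y - (y - r • x) := by abel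
    rw [← hrx, this]; exact norm_sub_le _ _
  set s := 1 - r ^ 2 with hs
  have hs0 : 0 < s := by nlinarith
  have hs1 : s ≤ 1 := by nlinarith
  have hσs : 1 - r ≤ s := by nlinarith
  have hsσ : s ≤ 2 * (1 - r) := by nlinarith
  have hwa : w ≤ a / 20 := by
    by_contra! hlt
    have k1 : s * R * d ≤ 2 * a * (a + w) := by
      have : s * R ≤ 2 * a := by rw [ha]; nlinarith
      gcongr
    nlinarith
  have hcone : BelowCone x y := ⟨by rw [← hd, ← hR, ← hY]; nlinarith, hN⟩
  obtain ⟨hdpos, hRd, hR9, -, hRY, -⟩ := hcone.bounds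
  rw [← hd, ← hR] at hRd
  rw [← hd] at hdpos
  rw [← hR] at hR9
  rw [← hd, ← hR, ← hY] at hRY
  have hRpos : 0 < R := by linarith
  have hperp : perpSq x y ≤ w ^ 2 := perpSq_le (norm_pos_iff.1 hRpos) y r
  have hperp0 := perpSq_nonneg x y
  have hσ : (1 - r) = a / R := by rw [ha]; field_simp
  set q := √s with hq
  have hq0 : 0 < q := Real.sqrt_pos.2 hs0
  have hq2 : q ^ 2 = s := Real.sq_sqrt hs0.le
  unfold mehlerMajorant coneKernel
  rw [← hs, ← hq, ← hR, ← hd, ← hY, ← hwdef, if_pos hcone]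
  split_ifs with hdY
  · set p := √(R / d) with hp
    have hp0 : 0 < p := by positivity
    have hp2 : p ^ 2 = R / d := Real.sq_sqrt (by positivity)
    have j1 : q⁻¹ ≤ 2 * p := by
      rw [inv_le_iff_one_le_mul₀ hq0]
      have : 1 ≤ (2 * p * q) ^ 2 := by
        rw [mul_pow, mul_pow, hp2, hq2]
        have : a / R ≤ s := by rw [← hσ]; exact hσs
        have k : R / d * (a / R) ≤ R / d * s := by gcongr
        have k' : R / d * (a / R) = a / d := by field_simp
        have k'' : 1 / 2 ≤ a / d := by rw [le_div_iff₀ hdpos]; linarith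
        linarith
      exact (one_le_sq_iff₀ (by positivity)).1 this
    have j2 : q ≤ 2 / p := by
      rw [le_div_iff₀ hp0]
      have : (q * p) ^ 2 ≤ 2 ^ 2 := by
        rw [mul_pow, hp2, hq2]
        have : s ≤ 2 * (a / R) := by rw [← hσ]; exact hsσ
        have k : s * (R / d) ≤ 2 * (a / R) * (R / d) := by gcongr
        have k' : 2 * (a / R) * (R / d) = 2 * (a / d) := by field_simp
        have k'' : a / d ≤ 2 := by rw [div_le_iff₀ hdpos]; linarith
        linarith
      exact (sq_le_sq₀ (by positivity) (by norm_num)).1 this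
    have j3 : 1 ≤ 2 * (R / p) := by
      have : 1 ≤ (2 * (R / p)) ^ 2 := by
        rw [mul_pow, div_pow, hp2]
        have : R ^ 2 / (R / d) = R * d := by field_simp
        rw [this]; linarith
      exact (one_le_sq_iff₀ (by positivity)).1 this
    have j4 : 1 + r * R * q ≤ 4 * (R / p) := by
      have : r * R * q ≤ 1 * R * (2 / p) := by gcongr
      have e : 1 * R * (2 / p) = 2 * (R / p) := by ring
      linarith
    have j5 : -(w ^ 2 / s) / 2 ≤ -(1 / 8) * perpSq x y * (R / d) := by
      have : R / d * s ≤ 4 := by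
        have : s ≤ 2 * (a / R) := by rw [← hσ]; exact hsσ
        have k : R / d * s ≤ R / d * (2 * (a / R)) := by gcongr
        have k' : R / d * (2 * (a / R)) = 2 * (a / d) := by field_simp
        have k'' : a / d ≤ 2 := by rw [div_le_iff₀ hdpos]; linarith
        linarith
      have k2 : R / d / 4 * perpSq x y ≤ w ^ 2 / s := by
        rw [le_div_iff₀ hs0]
        calc R / d / 4 * perpSq x y * s = (R / d * s) / 4 * perpSq x y := by ring
          _ ≤ 4 / 4 * perpSq x y := by gcongr
          _ ≤ w ^ 2 := by linarith
      linarith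
    calc r ^ m * q⁻¹ ^ (m + 1) * (1 + r * R * q) * exp (-(w ^ 2 / s) / 2)
        ≤ 1 * (2 * p) ^ (m + 1) * (4 * (R / p)) * exp (-(1 / 8) * perpSq x y * (R / d)) := by
          gcongr
          exact pow_le_one₀ hr.le hr1.le
      _ = 2 ^ (m + 1) * 4 * (R * p ^ m * exp (-(1 / 8) * perpSq x y * (R / d))) := by
          rw [mul_pow, pow_succ p]; field_simp
      _ ≤ _ := by
          gcongr
          have : 0 < 2 ^ (m + 1) * K := by positivity
          linarith
  · have hs4 : 1 / 4 ≤ s := by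
      have : 1 / 4 ≤ 1 - r := by rw [hσ, le_div_iff₀ hRpos]; linarith
      linarith
    have j1 : q⁻¹ ≤ 2 := by
      rw [inv_le_comm₀ hq0 (by norm_num), hq]
      exact Real.le_sqrt_of_sq_le (by linarith)
    have hq1 : q ≤ 1 := Real.sqrt_le_one.2 hs1
    have j2 : r ^ m * (1 + r * R * q) ≤ R⁻¹ ^ m * ((1 + Y) ^ (m + 1) * (1 + w) ^ (m + 1)) := by
      have e : r ^ m = R⁻¹ ^ m * (r * R) ^ m := by
        rw [← mul_pow]; congr 1; field_simp
      rw [e, mul_assoc]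
      refine mul_le_mul_of_nonneg_left ?_ (by positivity)
      have k0 : 0 ≤ r * R := by positivity
      calc (r * R) ^ m * (1 + r * R * q) ≤ (1 + r * R) ^ m * (1 + r * R * 1) := by
            gcongr
            linarith
        _ = (1 + r * R) ^ (m + 1) := by ring
        _ ≤ ((1 + Y) * (1 + w)) ^ (m + 1) := by
            gcongr
            nlinarith
        _ = _ := mul_pow _ _ _
    have j3 : exp (-(w ^ 2 / s) / 2) ≤ exp (-(1 / 4) * w ^ 2) * exp (-(1 / 8) * perpSq x y) := by
      rw [← exp_add, exp_le_exp]
      have : w ^ 2 ≤ w ^ 2 / s := by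
        rw [le_div_iff₀ hs0]
        exact mul_le_of_le_one_right (by positivity) hs1
      linarith
    calc r ^ m * q⁻¹ ^ (m + 1) * (1 + r * R * q) * exp (-(w ^ 2 / s) / 2)
        = q⁻¹ ^ (m + 1) * (r ^ m * (1 + r * R * q)) * exp (-(w ^ 2 / s) / 2) := by ring
      _ ≤ 2 ^ (m + 1) * (R⁻¹ ^ m * ((1 + Y) ^ (m + 1) * (1 + w) ^ (m + 1))) *
            (exp (-(1 / 4) * w ^ 2) * exp (-(1 / 8) * perpSq x y)) := by gcongr
      _ = 2 ^ (m + 1) * ((1 + w) ^ (m + 1) * exp (-(1 / 4) * w ^ 2)) *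
            (R⁻¹ ^ m * (1 + Y) ^ (m + 1) * exp (-(1 / 8) * perpSq x y)) := by ring
      _ ≤ 2 ^ (m + 1) * K * (R⁻¹ ^ m * (1 + Y) ^ (m + 1) * exp (-(1 / 8) * perpSq x y)) := by
          gcongr
          exact H w hw0
      _ ≤ _ := by
          gcongr
          have : (0 : ℝ) < 2 ^ (m + 1) * 4 := by positivity
          linarith

theorem mehlerMajorant_le (m : ℕ) :
    ∃ C : ℝ, 0 < C ∧ ∀ {V : Type} [NormedAddCommGroup V] [InnerProductSpace ℝ V] (r : ℝ) (x y : V),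
      0 < r → r < 1 → ¬ (‖x - y‖ ≤ 1 ∧ ‖x - y‖ * ‖x‖ ≤ 1) →
      mehlerMajorant m r x y ≤ C * ((1 + ‖x‖) ^ (m + 1) *
        exp (-(1 / 12000) * ((1 + ‖y‖) * ‖x - y‖)) + coneKernel m x y) := by
  obtain ⟨C₁, hC₁, H₁⟩ := majorant_offCone_le m
  obtain ⟨C₂, hC₂, H₂⟩ := mehlerMajorant_le_coneKernel m
  refine ⟨C₁ + C₂, by positivity, ?_⟩
  intro V _ _ r x y hr hr1 hN
  have hk := coneKernel_nonneg m x y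
  set G := (1 + ‖x‖) ^ (m + 1) * exp (-(1 / 12000) * ((1 + ‖y‖) * ‖x - y‖)) with hG
  have hG0 : 0 ≤ G := by positivity
  have hle : C₁ * G ≤ (C₁ + C₂) * (G + coneKernel m x y) ∧
      C₂ * coneKernel m x y ≤ (C₁ + C₂) * (G + coneKernel m x y) := by
    constructor <;> gcongr <;> linarith
  rcases lt_or_ge (‖y - r • x‖ ^ 2) (1 / 1000 * ((1 - r ^ 2) * ‖x‖ * ‖x - y‖)) with h | h
  · exact (H₂ r x y hr hr1 hN h).trans hle.2
  · refine le_trans ?_ hle.1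
    have hax : ‖(1 - r) • x‖ = (1 - r) * ‖x‖ := by
      rw [norm_smul, Real.norm_eq_abs, abs_of_pos (by linarith)]
    have hrx : ‖r • x‖ = r * ‖x‖ := by rw [norm_smul, Real.norm_eq_abs, abs_of_pos hr]
    refine H₁ r (1 - r ^ 2) ‖x‖ ‖x - y‖ ‖y - r • x‖ ‖y‖ hr hr1 rfl (norm_nonneg _) (norm_nonneg _)
      (norm_nonneg _) (norm_nonneg _) ?_ ?_ ?_ (norm_sub_le _ _) ?_ h
    · rw [← hax]
      have : x - y = (1 - r) • x - (y - r • x) := by rw [sub_smul, one_smul]; abel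
      rw [this]; exact norm_sub_le _ _
    · rw [← hax]
      have : (1 - r) • x = (x - y) + (y - r • x) := by rw [sub_smul, one_smul]; abel
      rw [this]; exact norm_add_le _ _
    · rw [← hrx]
      have : y = r • x + (y - r • x) := by abel
      nth_rewrite 1 [this]; exact norm_add_le _ _
    · by_contra! hlt
      refine hN ⟨?_, ?_⟩ <;> nlinarith [norm_nonneg x, norm_nonneg (x - y)]

theorem heatKerA_eq (n : ℕ) {t : ℝ} (ht : 0 < t) (x y : EuclideanSpace ℝ (Fin n)) :
    heatKerA n t x y = π ^ (-(n : ℝ) / 2) * exp (‖y‖ ^ 2 - ‖x‖ ^ 2) *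
      (exp (-(n : ℝ) * t) * (1 - exp (-2 * t)) ^ (-(n : ℝ) / 2) *
        exp (-(‖y‖ ^ 2 - 2 * (exp (-t) * inner ℝ x y) + exp (-2 * t) * ‖x‖ ^ 2) /
          (1 - exp (-2 * t)))) := by
  have h2 : exp (-2 * t) = exp (-t) ^ 2 := by rw [← exp_nat_mul]; congr 1; push_cast; ring
  have hs : 0 < 1 - exp (-2 * t) := by
    rw [sub_pos, exp_lt_one_iff]; linarith
  have key : exp (-‖x - exp (-t) • y‖ ^ 2 / (1 - exp (-2 * t))) = exp (‖y‖ ^ 2 - ‖x‖ ^ 2) *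
      exp (-(‖y‖ ^ 2 - 2 * (exp (-t) * inner ℝ x y) + exp (-2 * t) * ‖x‖ ^ 2) /
          (1 - exp (-2 * t))) := by
    rw [← exp_add, exp_eq_exp, norm_sub_sq_real, norm_smul, real_inner_smul_right, mul_pow,
      Real.norm_eq_abs, sq_abs, div_eq_iff hs.ne', add_mul, div_mul_cancel₀ _ hs.ne', h2]
    ring
  rw [heatKerA, key]
  ring

theorem hasDerivAt_mehler (ν b X Y : ℝ) {t : ℝ} (ht : 0 < t) :
    HasDerivAt (fun t => exp (-ν * t) * (1 - exp (-2 * t)) ^ (-ν / 2) *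
        exp (-(Y - 2 * (exp (-t) * b) + exp (-2 * t) * X) / (1 - exp (-2 * t))))
      (exp (-ν * t) * (1 - exp (-2 * t)) ^ (-ν / 2) *
        exp (-(Y - 2 * (exp (-t) * b) + exp (-2 * t) * X) / (1 - exp (-2 * t))) *
        (-ν / (1 - exp (-2 * t)) - 2 * exp (-t) * (b - exp (-t) * X) / (1 - exp (-2 * t)) +
          2 * exp (-t) ^ 2 * (Y - 2 * (exp (-t) * b) + exp (-2 * t) * X) /
            (1 - exp (-2 * t)) ^ 2)) t := by
  have h2 : exp (-2 * t) = exp (-t) ^ 2 := by rw [← exp_nat_mul]; congr 1; push_cast; ring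
  have hs : 0 < 1 - exp (-2 * t) := by
    rw [sub_pos, exp_lt_one_iff]; linarith
  have d1 : HasDerivAt (fun t : ℝ => exp (-ν * t)) (exp (-ν * t) * (-ν)) t := by
    simpa using ((hasDerivAt_id t).const_mul (-ν)).exp
  have d2 : HasDerivAt (fun t : ℝ => exp (-2 * t)) (exp (-2 * t) * (-2)) t := by
    simpa using ((hasDerivAt_id t).const_mul (-2)).exp
  have d3 : HasDerivAt (fun t : ℝ => exp (-t)) (-exp (-t)) t := by
    simpa using (hasDerivAt_id t).neg.exp
  have d4 := d2.const_sub 1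
  have d5 := d4.rpow_const (p := -ν / 2) (Or.inl hs.ne')
  have d6 := ((((d3.mul_const b).const_mul 2).const_sub Y).add (d2.mul_const X)).neg.div d4 hs.ne'
  refine ((d1.mul d5).mul d6.exp).congr_deriv ?_
  simp only [Pi.mul_apply, Pi.div_apply, Pi.neg_apply, Pi.add_apply]
  rw [rpow_sub hs, rpow_one]
  set s := 1 - exp (-2 * t) with hsdef
  have e : exp (-2 * t) = 1 - s := by rw [hsdef]; ring
  have e2 : exp (-t) ^ 2 = 1 - s := by rw [← h2, e]
  clear_value s
  set P := s ^ (-ν / 2)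
  set Q := exp (-(Y - 2 * (exp (-t) * b) + exp (-2 * t) * X) / s)
  rw [e2, e]
  set r := exp (-t)
  clear_value P Q r
  field_simp
  linear_combination (-2 * s * X * P * Q) * e2

set_option maxHeartbeats 800000 in
theorem abs_deriv_heatKerA_le (m : ℕ) {t : ℝ} (ht : 0 < t)
    (x y : EuclideanSpace ℝ (Fin (m + 1))) :
    t * |deriv (fun s => heatKerA (m + 1) s x y) t| ≤
      π ^ (-((m + 1 : ℕ) : ℝ) / 2) * (m + 5) *
        (exp (‖y‖ ^ 2 - ‖x‖ ^ 2) * mehlerMajorant m (exp (-t)) x y) := by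
  have hev : (fun s => heatKerA (m + 1) s x y) =ᶠ[nhds t] _ :=
    Filter.eventuallyEq_of_mem (Ioi_mem_nhds ht) fun s hs => heatKerA_eq (m + 1) hs x y
  rw [hev.deriv_eq, ((hasDerivAt_mehler _ _ _ _ ht).const_mul _).deriv, abs_mul]
  rw [abs_mul (exp _ * _ * _), abs_of_nonneg (a := π ^ (-((m + 1 : ℕ) : ℝ) / 2) * _)
    (by positivity)]
  have h2 : exp (-2 * t) = exp (-t) ^ 2 := by rw [← exp_nat_mul]; congr 1; push_cast; ring
  have hr1 : exp (-t) < 1 := by rw [exp_lt_one_iff]; linarith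
  have htr : t * exp (-t) ≤ 1 - exp (-t) ^ 2 := by
    have h := add_one_le_exp t
    have h' : exp (-t) * exp t = 1 := by rw [← exp_add]; simp
    nlinarith [exp_pos (-t)]
  have hrm : exp (-((m + 1 : ℕ) : ℝ) * t) = exp (-t) ^ (m + 1) := by
    rw [← exp_nat_mul]; congr 1; ring
  rw [h2, hrm]
  set r := exp (-t) with hr
  have hr0 : 0 < r := exp_pos _
  have hs : 0 < 1 - r ^ 2 := by nlinarith
  have hpow : (1 - r ^ 2) ^ (-((m + 1 : ℕ) : ℝ) / 2) = (√(1 - r ^ 2))⁻¹ ^ (m + 1) := by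
    rw [inv_pow, sqrt_eq_rpow, ← rpow_natCast _ (m + 1), ← rpow_mul hs.le, ← rpow_neg hs.le]
    congr 1; ring
  have hnorm : ‖y‖ ^ 2 - 2 * (r * inner ℝ x y) + r ^ 2 * ‖x‖ ^ 2 = ‖y - r • x‖ ^ 2 := by
    rw [norm_sub_sq_real, norm_smul, real_inner_smul_right, mul_pow, Real.norm_eq_abs, sq_abs,
      real_inner_comm]
  rw [hpow, hnorm]
  unfold mehlerMajorant
  have hb : |inner ℝ x y - r * ‖x‖ ^ 2| ≤ ‖x‖ * ‖y - r • x‖ := by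
    have : inner ℝ x y - r * ‖x‖ ^ 2 = inner ℝ x (y - r • x) := by
      rw [inner_sub_right, real_inner_smul_right, real_inner_self_eq_norm_sq]
    rw [this]; exact abs_real_inner_le_norm _ _
  set s := 1 - r ^ 2 with hsdef
  set w := ‖y - r • x‖ with hw
  set q := √s with hq
  have hq0 : 0 < q := Real.sqrt_pos.2 hs
  have hq2 : q ^ 2 = s := Real.sq_sqrt hs.le
  set v := w / q with hv
  have hv0 : 0 ≤ v := by positivity
  have hU : w ^ 2 / s = v ^ 2 := by rw [hv, div_pow, hq2]
  have hwv : w = v * q := by rw [hv]; field_simp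
  have hts : t / s ≤ r⁻¹ := by
    rw [div_le_iff₀ hs, inv_mul_eq_div, le_div_iff₀ hr0]; exact htr
  have hD : |-((m + 1 : ℕ) : ℝ) / s - 2 * r * (inner ℝ x y - r * ‖x‖ ^ 2) / s +
      2 * r ^ 2 * w ^ 2 / s ^ 2| ≤ (1 / s) * ((m + 1) + 2 * (r * ‖x‖ * q) * v + 2 * v ^ 2) := by
    have e : -((m + 1 : ℕ) : ℝ) / s - 2 * r * (inner ℝ x y - r * ‖x‖ ^ 2) / s +
      2 * r ^ 2 * w ^ 2 / s ^ 2 = (1 / s) * (-(m + 1) - 2 * r * (inner ℝ x y - r * ‖x‖ ^ 2) +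
        2 * r ^ 2 * v ^ 2) := by
      rw [← hU]; push_cast; field_simp
    rw [e, abs_mul, abs_of_pos (by positivity)]
    refine mul_le_mul_of_nonneg_left ?_ (by positivity)
    have h1 : 2 * r * |inner ℝ x y - r * ‖x‖ ^ 2| ≤ 2 * r * (‖x‖ * w) := by gcongr
    have h3 : |2 * r * (inner ℝ x y - r * ‖x‖ ^ 2)| =
        2 * r * |inner ℝ x y - r * ‖x‖ ^ 2| := by
      rw [abs_mul, abs_of_pos (by positivity)]
    have h4 : 2 * r ^ 2 * v ^ 2 ≤ 2 * v ^ 2 := by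
      have : r ^ 2 * v ^ 2 ≤ v ^ 2 := mul_le_of_le_one_left (by positivity) (by linarith)
      linarith
    have h5 : 2 * r * (‖x‖ * w) = 2 * (r * ‖x‖ * q) * v := by rw [hwv]; ring
    have h6 : 0 ≤ 2 * r ^ 2 * v ^ 2 := by positivity
    have h7 : (0 : ℝ) ≤ m := Nat.cast_nonneg m
    rw [abs_le]
    have := abs_le.1 (h3.le.trans h1)
    constructor <;> linarith
  have hE : exp (-w ^ 2 / s) = exp (-(w ^ 2 / s) / 2) * exp (-v ^ 2 / 2) := by
    rw [← exp_add, neg_div, hU]; congr 1; ring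
  set B := r * ‖x‖ * q with hB
  have hB0 : 0 ≤ B := by positivity
  have hfin : exp (-v ^ 2 / 2) * ((m + 1) + 2 * B * v + 2 * v ^ 2) ≤ (m + 5) * (1 + B) := by
    have h1 := add_one_le_exp (v ^ 2 / 2)
    have h3 : exp (-v ^ 2 / 2) * exp (v ^ 2 / 2) = 1 := by
      rw [← exp_add, neg_div]; simp
    have h7 : (0 : ℝ) ≤ m := Nat.cast_nonneg m
    have h8 : (m + 1) + 2 * B * v + 2 * v ^ 2 ≤ (m + 5) * (1 + B) * exp (v ^ 2 / 2) := by
      have h9 : (m + 5) * (1 + B) * (v ^ 2 / 2 + 1) ≤ (m + 5) * (1 + B) * exp (v ^ 2 / 2) := by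
        gcongr
      have h10 : 5 * (1 + B) * (v ^ 2 / 2 + 1) + m ≤ (m + 5) * (1 + B) * (v ^ 2 / 2 + 1) := by
        have : m * (1 * 1) ≤ m * ((1 + B) * (v ^ 2 / 2 + 1)) := by
          gcongr
          · linarith
          · nlinarith [sq_nonneg v]
        linarith
      have h11 : B * (2 * v) ≤ B * (5 * (v ^ 2 / 2 + 1)) := by
        refine mul_le_mul_of_nonneg_left ?_ hB0
        nlinarith [sq_nonneg (v - 1)]
      linarith [sq_nonneg v]
    calc exp (-v ^ 2 / 2) * ((m + 1) + 2 * B * v + 2 * v ^ 2)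
        ≤ exp (-v ^ 2 / 2) * ((m + 5) * (1 + B) * exp (v ^ 2 / 2)) := by gcongr
      _ = (m + 5) * (1 + B) * (exp (-v ^ 2 / 2) * exp (v ^ 2 / 2)) := by ring
      _ = _ := by rw [h3, mul_one]
  rw [hE, abs_of_pos (by positivity)]
  set D := |-((m + 1 : ℕ) : ℝ) / s - 2 * r * (inner ℝ x y - r * ‖x‖ ^ 2) / s +
      2 * r ^ 2 * w ^ 2 / s ^ 2|
  set p := π ^ (-((m + 1 : ℕ) : ℝ) / 2)
  have hp : 0 < p := by positivity
  set A := p * exp (‖y‖ ^ 2 - ‖x‖ ^ 2) * r ^ m * q⁻¹ ^ (m + 1) * exp (-(w ^ 2 / s) / 2) with hA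
  have hA0 : 0 ≤ A := by positivity
  have htD : t * D ≤ r⁻¹ * ((m + 1) + 2 * B * v + 2 * v ^ 2) := by
    calc t * D ≤ t * ((1 / s) * ((m + 1) + 2 * B * v + 2 * v ^ 2)) := by gcongr
      _ = (t / s) * ((m + 1) + 2 * B * v + 2 * v ^ 2) := by ring
      _ ≤ _ := by gcongr
  calc _ = A * r * exp (-v ^ 2 / 2) * (t * D) := by rw [hA]; ring
    _ ≤ A * r * exp (-v ^ 2 / 2) * (r⁻¹ * ((m + 1) + 2 * B * v + 2 * v ^ 2)) := by gcongr
    _ = A * (exp (-v ^ 2 / 2) * ((m + 1) + 2 * B * v + 2 * v ^ 2)) := by field_simp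
    _ ≤ A * ((m + 5) * (1 + B)) := by gcongr
    _ = _ := by rw [hA]; ring

theorem integrable_exp_neg_norm (d : ℕ) :
    Integrable fun z : EuclideanSpace ℝ (Fin d) => exp (-‖z‖) := by
  obtain ⟨C, hC, H⟩ := exists_one_add_pow_mul_exp_neg_le (d + 1) (c := 1) one_pos
  have h := (integrable_one_add_norm (E := EuclideanSpace ℝ (Fin d)) (μ := volume)
    (r := (d + 1 : ℕ)) (by simp)).const_mul C
  refine h.mono' (by fun_prop) (ae_of_all _ fun z => ?_)
  have := H ‖z‖ (norm_nonneg _)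
  rw [Real.norm_eq_abs, abs_of_pos (exp_pos _), rpow_neg (by positivity), rpow_natCast,
    ← div_eq_mul_inv, le_div_iff₀ (by positivity)]
  simpa [mul_comm] using this

theorem exists_lintegral_exp_neg_mul_norm_le (d : ℕ) :
    ∃ C : ℝ, 0 < C ∧ ∀ (κ : ℝ) (b : EuclideanSpace ℝ (Fin d)), 0 < κ →
      ∫⁻ z : EuclideanSpace ℝ (Fin d), ENNReal.ofReal (exp (-κ * ‖z - b‖)) ≤
        ENNReal.ofReal (C * κ⁻¹ ^ d) := by
  refine ⟨1 + ∫ z : EuclideanSpace ℝ (Fin d), exp (-‖z‖), ?_, fun κ b hκ => ?_⟩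
  · have : 0 ≤ ∫ z : EuclideanSpace ℝ (Fin d), exp (-‖z‖) := integral_nonneg fun _ => (exp_pos _).le
    linarith
  rw [lintegral_sub_right_eq_self (fun z : EuclideanSpace ℝ (Fin d) =>
    ENNReal.ofReal (exp (-κ * ‖z‖))) b]
  have hi : Integrable fun z : EuclideanSpace ℝ (Fin d) => exp (-‖κ • z‖) :=
    (integrable_exp_neg_norm d).comp_smul hκ.ne'
  have e : (fun z : EuclideanSpace ℝ (Fin d) => exp (-κ * ‖z‖)) = fun z => exp (-‖κ • z‖) := by
    ext z; rw [norm_smul, Real.norm_eq_abs, abs_of_pos hκ, neg_mul]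
  rw [show (fun z : EuclideanSpace ℝ (Fin d) => ENNReal.ofReal (exp (-κ * ‖z‖))) =
    fun z => ENNReal.ofReal (exp (-‖κ • z‖)) from funext fun z => by rw [congrFun e z],
    ← ofReal_integral_eq_lintegral_ofReal hi (ae_of_all _ fun _ => (exp_pos _).le)]
  refine ENNReal.ofReal_le_ofReal ?_
  rw [Measure.integral_comp_smul volume (fun z : EuclideanSpace ℝ (Fin d) => exp (-‖z‖)) κ,
    finrank_euclideanSpace_fin, abs_of_pos (by positivity), smul_eq_mul, mul_comm, inv_pow]
  gcongr
  linarith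

/-- Two points are related when their distance is controlled by the difference of their norms, up
to their critical radii. -/
def ZoneRel {V : Type*} [NormedAddCommGroup V] (L : ℝ) (a b : V) : Prop :=
  ‖a - b‖ ≤ L * |‖a‖ - ‖b‖| + 1 / (1 + ‖a‖) + 1 / (1 + ‖b‖)

theorem ZoneRel.symm {V : Type*} [NormedAddCommGroup V] {L : ℝ} {a b : V} (h : ZoneRel L a b) :
    ZoneRel L b a := by
  unfold ZoneRel at *
  rw [norm_sub_rev, abs_sub_comm]
  linarith

theorem ZoneRel.refl {V : Type*} [NormedAddCommGroup V] (L : ℝ) (a : V) : ZoneRel L a a := by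
  unfold ZoneRel
  simp only [sub_self, norm_zero, abs_zero, mul_zero, zero_add]
  positivity

theorem ZoneRel.norm_sq_le {V : Type*} [NormedAddCommGroup V] {L : ℝ} (hL : 0 ≤ L) {a b : V}
    (h : ZoneRel L a b) (hab : ‖a‖ ^ 2 ≤ ‖b‖ ^ 2 + 1) :
    ‖a‖ ^ 2 ≤ ‖b‖ ^ 2 + 3 - (1 + ‖b‖) / (2 * L + 1) * ‖a - b‖ := by
  have hA := norm_nonneg a
  have hB := norm_nonneg b
  have h1 : (1 + ‖b‖) * ‖a - b‖ ≤ (1 + ‖b‖) * (L * |‖a‖ - ‖b‖|) + (1 + ‖b‖) / (1 + ‖a‖) + 1 := by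
    have := mul_le_mul_of_nonneg_left h (by positivity : 0 ≤ 1 + ‖b‖)
    refine this.trans (le_of_eq ?_)
    field_simp
  have h2 : (1 + ‖b‖) / (2 * L + 1) * ‖a - b‖ = ((1 + ‖b‖) * ‖a - b‖) / (2 * L + 1) := by ring
  rw [h2]
  suffices (1 + ‖b‖) * ‖a - b‖ ≤ (‖b‖ ^ 2 + 3 - ‖a‖ ^ 2) * (2 * L + 1) by
    have := (div_le_iff₀ (by positivity)).2 this
    linarith
  refine h1.trans ?_
  clear h h1 h2
  generalize ‖a‖ = A at *
  generalize ‖b‖ = B at *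
  rcases le_total A B with hAB | hAB
  · obtain ⟨t, rfl⟩ : ∃ t, B = A + t := ⟨B - A, by ring⟩
    have ht : 0 ≤ t := by linarith
    have e1 : |A - (A + t)| = t := by rw [abs_sub_comm]; simp [abs_of_nonneg ht]
    have e2 : (1 + (A + t)) / (1 + A) ≤ 1 + t := by
      rw [div_le_iff₀ (by positivity)]
      nlinarith
    rw [e1]
    have e3 : t ≤ t * (A + t) + 1 := by
      rcases le_total t 1 with h | h
      · have : 0 ≤ t * (A + t) := by positivity
        linarith
      · nlinarith
    have e4 : L * t ≤ L * (t * (A + t) + 1) := by gcongr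
    have e5 : 0 ≤ t * A := by positivity
    have e6 : 0 ≤ L * (t * A) := by positivity
    nlinarith
  · obtain ⟨t, rfl⟩ : ∃ t, A = B + t := ⟨A - B, by ring⟩
    have ht : 0 ≤ t := by linarith
    have e1 : |B + t - B| = t := by simp [abs_of_nonneg ht]
    have e2 : (1 + B) / (1 + (B + t)) ≤ 1 := by
      rw [div_le_one (by positivity)]; linarith
    rw [e1]
    have e0 : 0 ≤ t * B := by positivity
    have ht1 : t ≤ 1 := by nlinarith
    have e3 : (1 + B) * t ≤ 2 := by nlinarith
    have e4 : L * ((1 + B) * t) ≤ L * 2 := by gcongr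
    have e5 : 0 ≤ (B ^ 2 + 1 - (B + t) ^ 2) * (2 * L + 1) := mul_nonneg (by linarith) (by linarith)
    linarith

theorem exists_gammaM1_zone_le (n : ℕ) {L : ℝ} (hL : 0 ≤ L) :
    ∃ C : ℝ, 0 < C ∧ ∀ b : EuclideanSpace ℝ (Fin n),
      gammaM1 n {a | ‖a‖ ^ 2 ≤ ‖b‖ ^ 2 + 1 ∧ ZoneRel L a b} ≤
        ENNReal.ofReal (C * (exp (‖b‖ ^ 2) * (1 + ‖b‖)⁻¹ ^ n)) := by
  obtain ⟨C, hC, H⟩ := exists_lintegral_exp_neg_mul_norm_le n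
  refine ⟨π ^ ((n : ℝ) / 2) * exp 3 * C * (2 * L + 1) ^ n, by positivity, fun b => ?_⟩
  set κ := (1 + ‖b‖) / (2 * L + 1) with hκdef
  have hκ : 0 < κ := by positivity
  set Z := {a : EuclideanSpace ℝ (Fin n) | ‖a‖ ^ 2 ≤ ‖b‖ ^ 2 + 1 ∧ ZoneRel L a b} with hZ
  have hZm : MeasurableSet Z := by
    have : IsClosed Z := by
      have e : Z = {a | ‖a‖ ^ 2 ≤ ‖b‖ ^ 2 + 1} ∩
        {a | ‖a - b‖ ≤ L * |‖a‖ - ‖b‖| + 1 / (1 + ‖a‖) + 1 / (1 + ‖b‖)} := rfl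
      rw [e]
      refine (isClosed_le (by fun_prop) (by fun_prop)).inter (isClosed_le (by fun_prop) ?_)
      have : ∀ a : EuclideanSpace ℝ (Fin n), 1 + ‖a‖ ≠ 0 := fun a => by positivity
      fun_prop (disch := assumption)
    exact this.measurableSet
  rw [gammaM1, withDensity_apply _ hZm]
  calc ∫⁻ a in Z, ENNReal.ofReal (π ^ ((n : ℝ) / 2) * exp (‖a‖ ^ 2))
      ≤ ∫⁻ a in Z, ENNReal.ofReal (π ^ ((n : ℝ) / 2) * exp (‖b‖ ^ 2 + 3)) *
          ENNReal.ofReal (exp (-κ * ‖a - b‖)) := by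
        refine setLIntegral_mono (by fun_prop) fun a ha => ?_
        rw [← ENNReal.ofReal_mul (by positivity), mul_assoc, ← exp_add]
        refine ENNReal.ofReal_le_ofReal ?_
        gcongr
        have := ha.2.norm_sq_le hL ha.1
        linarith
    _ ≤ ∫⁻ a, ENNReal.ofReal (π ^ ((n : ℝ) / 2) * exp (‖b‖ ^ 2 + 3)) *
          ENNReal.ofReal (exp (-κ * ‖a - b‖)) := setLIntegral_le_lintegral _ _
    _ = ENNReal.ofReal (π ^ ((n : ℝ) / 2) * exp (‖b‖ ^ 2 + 3)) *
          ∫⁻ a, ENNReal.ofReal (exp (-κ * ‖a - b‖)) := lintegral_const_mul _ (by fun_prop)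
    _ ≤ ENNReal.ofReal (π ^ ((n : ℝ) / 2) * exp (‖b‖ ^ 2 + 3)) *
          ENNReal.ofReal (C * κ⁻¹ ^ n) := by gcongr; exact H κ b hκ
    _ = _ := by
      rw [← ENNReal.ofReal_mul (by positivity), hκdef, inv_div, div_pow, exp_add, inv_pow]
      congr 1
      field_simp

theorem exists_zoneRel_selection {V : Type*} [NormedAddCommGroup V] (L : ℝ) {A : Set V} {M : ℝ}
    (hA : ∀ a ∈ A, ‖a‖ ≤ M) :
    ∃ u ⊆ A, Separated L u ∧ ∀ a ∈ A, ∃ b ∈ u, ‖a‖ ^ 2 ≤ ‖b‖ ^ 2 + 1 ∧ ZoneRel L a b := by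
  have hrel : ∀ a b : V, (({p : V × V | (p.1 = a ∨ p.2 = a) ∧ ZoneRel L p.1 p.2}) ∩
      {p : V × V | (p.1 = b ∨ p.2 = b) ∧ ZoneRel L p.1 p.2}).Nonempty ↔ ZoneRel L a b := by
    intro a b
    constructor
    · rintro ⟨⟨p, q⟩, ⟨h1, h2⟩, h3, -⟩
      rcases h1 with rfl | rfl <;> rcases h3 with rfl | rfl
      · exact ZoneRel.refl L _
      · exact h2
      · exact h2.symm
      · exact ZoneRel.refl L _
    · exact fun h => ⟨(a, b), ⟨Or.inl rfl, h⟩, Or.inr rfl, h⟩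
  obtain ⟨u, huA, hdisj, hcov⟩ := Vitali.exists_disjoint_subfamily_covering_enlargement
    (fun a : V => {p : V × V | (p.1 = a ∨ p.2 = a) ∧ ZoneRel L p.1 p.2}) A
    (fun a => exp (‖a‖ ^ 2)) (exp 1) (by simp) (fun a _ => (exp_pos _).le) (exp (M ^ 2))
    (fun a ha => exp_le_exp.2 (pow_le_pow_left₀ (norm_nonneg _) (hA a ha) 2))
    (fun a _ => ⟨(a, a), Or.inl rfl, ZoneRel.refl L a⟩)
  refine ⟨u, huA, ?_, ?_⟩
  · intro x hx x' hx' hne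
    by_contra! hlt
    refine Set.not_disjoint_iff_nonempty_inter.2 ((hrel x x').2 ?_) (hdisj hx hx' hne)
    unfold ZoneRel
    have : 0 ≤ 1 / (1 + ‖x'‖) := by positivity
    linarith
  · intro a ha
    obtain ⟨b, hb, h, hle⟩ := hcov a ha
    refine ⟨b, hb, ?_, (hrel a b).1 h⟩
    rw [← exp_add, exp_le_exp] at hle
    linarith

theorem sum_lintegral_le_lintegral_sum {α ι : Type*} [MeasurableSpace α] (μ : Measure α)
    (X : Finset ι) (F : ι → α → ℝ≥0∞) :
    ∑ i ∈ X, ∫⁻ a, F i a ∂μ ≤ ∫⁻ a, ∑ i ∈ X, F i a ∂μ := by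
  classical
  induction X using Finset.induction_on with
  | empty => simp
  | insert i X hi ih =>
    simp_rw [Finset.sum_insert hi]
    exact (add_le_add_right ih _).trans (le_lintegral_add _ _)

theorem weakType_coneKernel (m : ℕ) :
    ∃ C : ℝ, 0 < C ∧ ∀ f : EuclideanSpace ℝ (Fin (m + 1)) → ℝ≥0∞, (∫⁻ y, f y) ≠ ⊤ →
      ∀ lam : ℝ, 0 < lam →
      gammaM1 (m + 1) {x | ENNReal.ofReal lam < ENNReal.ofReal (exp (-‖x‖ ^ 2)) *
          ∫⁻ y, ENNReal.ofReal (coneKernel m x y) * f y} ≤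
        ENNReal.ofReal (C / lam) * ∫⁻ y, f y := by
  have hm : (0 : ℝ) ≤ m := Nat.cast_nonneg m
  set c : ℝ := 1 / (2 * (m + 1)) with hc
  have hc0 : 0 < c := by positivity
  obtain ⟨C₁, hC₁, H₁⟩ := sum_coneKernel_le m hc0
    (by rw [hc]; apply one_div_le_one_div_of_le <;> linarith)
    (by rw [hc]; field_simp; norm_num)
  obtain ⟨C₂, hC₂, H₂⟩ := exists_gammaM1_zone_le (m + 1) (L := 2 / c) (by positivity)
  refine ⟨C₂ * C₁, by positivity, fun f hf lam hlam => ?_⟩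
  set S := {x | ENNReal.ofReal lam < ENNReal.ofReal (exp (-‖x‖ ^ 2)) *
          ∫⁻ y, ENNReal.ofReal (coneKernel m x y) * f y} with hS
  have hSU : S = ⋃ k : ℕ, S ∩ Metric.closedBall 0 k := by
    rw [← Set.inter_iUnion, Metric.iUnion_closedBall_nat, Set.inter_univ]
  have hmono : Monotone fun k : ℕ => S ∩ Metric.closedBall 0 (k : ℝ) := fun i j hij =>
    Set.inter_subset_inter_right _ (Metric.closedBall_subset_closedBall (by exact_mod_cast hij))
  rw [hSU, hmono.measure_iUnion]
  refine iSup_le fun k => ?_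
  obtain ⟨u, huA, hsep, hcov⟩ := exists_zoneRel_selection (2 / c)
    (A := S ∩ Metric.closedBall 0 (k : ℝ)) (M := k) (fun a ha => by simpa using ha.2)
  set wt : EuclideanSpace ℝ (Fin (m + 1)) → ℝ := fun b => exp (‖b‖ ^ 2) * (1 + ‖b‖)⁻¹ ^ (m + 1)
    with hwt
  have hwt0 : ∀ b, 0 < wt b := fun b => by positivity
  have hpt : ∀ b ∈ u, ENNReal.ofReal (wt b) ≤ ENNReal.ofReal (1 / lam) *
      ∫⁻ y, ENNReal.ofReal ((1 + ‖b‖)⁻¹ ^ (m + 1) * coneKernel m b y) * f y := by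
    intro b hb
    have hbS : ENNReal.ofReal lam < ENNReal.ofReal (exp (-‖b‖ ^ 2)) *
          ∫⁻ y, ENNReal.ofReal (coneKernel m b y) * f y := (huA hb).1
    have e1 : ∫⁻ y, ENNReal.ofReal ((1 + ‖b‖)⁻¹ ^ (m + 1) * coneKernel m b y) * f y =
        ENNReal.ofReal ((1 + ‖b‖)⁻¹ ^ (m + 1)) *
          ∫⁻ y, ENNReal.ofReal (coneKernel m b y) * f y := by
      rw [← lintegral_const_mul' _ _ ENNReal.ofReal_ne_top]
      refine lintegral_congr fun y => ?_
      rw [ENNReal.ofReal_mul (by positivity), mul_assoc]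
    rw [e1]
    set J := ∫⁻ y, ENNReal.ofReal (coneKernel m b y) * f y
    have e2 : wt b = 1 / lam * (1 + ‖b‖)⁻¹ ^ (m + 1) * exp (‖b‖ ^ 2) * lam := by
      rw [hwt]; field_simp
    have e3 : 1 / lam * (1 + ‖b‖)⁻¹ ^ (m + 1) * exp (‖b‖ ^ 2) * exp (-‖b‖ ^ 2) =
        1 / lam * (1 + ‖b‖)⁻¹ ^ (m + 1) := by
      rw [mul_assoc, ← exp_add, ← sub_eq_add_neg, sub_self, exp_zero, mul_one]
    calc ENNReal.ofReal (wt b) = ENNReal.ofReal (1 / lam * (1 + ‖b‖)⁻¹ ^ (m + 1) *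
            exp (‖b‖ ^ 2)) * ENNReal.ofReal lam := by
          rw [← ENNReal.ofReal_mul (by positivity), ← e2]
      _ ≤ ENNReal.ofReal (1 / lam * (1 + ‖b‖)⁻¹ ^ (m + 1) * exp (‖b‖ ^ 2)) *
            (ENNReal.ofReal (exp (-‖b‖ ^ 2)) * J) := by gcongr
      _ = _ := by
          rw [← mul_assoc, ← ENNReal.ofReal_mul (by positivity), e3,
            ENNReal.ofReal_mul (by positivity), mul_assoc]
  have hsum : ∑' b : u, ENNReal.ofReal (wt b) ≤ ENNReal.ofReal (C₁ / lam) * ∫⁻ y, f y := by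
    rw [ENNReal.tsum_eq_iSup_sum]
    refine iSup_le fun X => ?_
    set X' := X.map (Function.Embedding.subtype _) with hX'
    have hX'u : ∀ x ∈ X', x ∈ u := by
      intro x hx
      obtain ⟨z, -, rfl⟩ := Finset.mem_map.1 hx
      exact z.2
    have e : ∑ b ∈ X, ENNReal.ofReal (wt b) = ∑ b ∈ X', ENNReal.ofReal (wt b) := by
      rw [hX', Finset.sum_map]; rfl
    rw [e]
    calc ∑ b ∈ X', ENNReal.ofReal (wt b)
        ≤ ∑ b ∈ X', ENNReal.ofReal (1 / lam) *
          ∫⁻ y, ENNReal.ofReal ((1 + ‖b‖)⁻¹ ^ (m + 1) * coneKernel m b y) * f y :=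
          Finset.sum_le_sum fun b hb => hpt b (hX'u b hb)
      _ ≤ ENNReal.ofReal (1 / lam) * ∫⁻ y, ∑ b ∈ X',
          ENNReal.ofReal ((1 + ‖b‖)⁻¹ ^ (m + 1) * coneKernel m b y) * f y := by
          rw [← Finset.mul_sum]
          gcongr
          exact sum_lintegral_le_lintegral_sum _ _ _
      _ ≤ ENNReal.ofReal (1 / lam) * ∫⁻ y, ENNReal.ofReal C₁ * f y := by
          gcongr with y
          rw [← Finset.sum_mul, ← ENNReal.ofReal_sum_of_nonneg fun b _ =>
            mul_nonneg (by positivity) (coneKernel_nonneg m b y)]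
          gcongr
          exact H₁ X' y (hsep.mono fun x hx => hX'u x hx)
      _ = ENNReal.ofReal (C₁ / lam) * ∫⁻ y, f y := by
          rw [lintegral_const_mul' _ _ ENNReal.ofReal_ne_top, ← mul_assoc,
            ← ENNReal.ofReal_mul (by positivity), one_div_mul_eq_div]
  have hcount : u.Countable := by
    have h := Summable.countable_support_ennreal
      (ne_top_of_le_ne_top (ENNReal.mul_ne_top ENNReal.ofReal_ne_top hf) hsum)
    rw [← Set.countable_coe_iff, ← Set.countable_univ_iff]
    refine h.mono fun b _ => ?_
    simpa using hwt0 b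
  calc gammaM1 (m + 1) (S ∩ Metric.closedBall 0 (k : ℝ))
      ≤ gammaM1 (m + 1) (⋃ b ∈ u, {a | ‖a‖ ^ 2 ≤ ‖b‖ ^ 2 + 1 ∧ ZoneRel (2 / c) a b}) := by
        refine measure_mono fun a ha => ?_
        obtain ⟨b, hb, h⟩ := hcov a ha
        exact Set.mem_biUnion hb h
    _ ≤ ∑' b : u, gammaM1 (m + 1) {a | ‖a‖ ^ 2 ≤ ‖(b : EuclideanSpace ℝ (Fin (m + 1)))‖ ^ 2 + 1 ∧
          ZoneRel (2 / c) a b} := measure_biUnion_le _ hcount _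
    _ ≤ ∑' b : u, ENNReal.ofReal C₂ * ENNReal.ofReal (wt b) := by
        refine ENNReal.tsum_le_tsum fun b => ?_
        rw [← ENNReal.ofReal_mul hC₂.le]
        exact H₂ b
    _ = ENNReal.ofReal C₂ * ∑' b : u, ENNReal.ofReal (wt b) := ENNReal.tsum_mul_left
    _ ≤ ENNReal.ofReal C₂ * (ENNReal.ofReal (C₁ / lam) * ∫⁻ y, f y) := by gcongr
    _ = _ := by rw [← mul_assoc, ← ENNReal.ofReal_mul hC₂.le, mul_div_assoc]

theorem exists_lintegral_expKernel_le (n : ℕ) {c : ℝ} (hc : 0 < c) :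
    ∃ C : ℝ, 0 < C ∧ ∀ y : EuclideanSpace ℝ (Fin n),
      ∫⁻ x : EuclideanSpace ℝ (Fin n),
        ENNReal.ofReal ((1 + ‖x‖) ^ n * exp (-c * ((1 + ‖y‖) * ‖x - y‖))) ≤ ENNReal.ofReal C := by
  obtain ⟨K, hK, HK⟩ := exists_one_add_pow_mul_exp_neg_le n (c := c / 2) (by positivity)
  obtain ⟨C, hC, H⟩ := exists_lintegral_exp_neg_mul_norm_le n
  refine ⟨K * C * (2 / c) ^ n, by positivity, fun y => ?_⟩
  set κ := c / 2 * (1 + ‖y‖) with hκdef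
  have hκ : 0 < κ := by positivity
  calc ∫⁻ x : EuclideanSpace ℝ (Fin n),
        ENNReal.ofReal ((1 + ‖x‖) ^ n * exp (-c * ((1 + ‖y‖) * ‖x - y‖)))
      ≤ ∫⁻ x : EuclideanSpace ℝ (Fin n), ENNReal.ofReal ((1 + ‖y‖) ^ n * K) *
          ENNReal.ofReal (exp (-κ * ‖x - y‖)) := by
        refine lintegral_mono fun x => ?_
        rw [← ENNReal.ofReal_mul (by positivity)]
        refine ENNReal.ofReal_le_ofReal ?_
        set d := ‖x - y‖ with hd
        have hd0 : 0 ≤ d := norm_nonneg _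
        have hx : ‖x‖ ≤ d + ‖y‖ := by
          have := norm_add_le (x - y) y
          rwa [sub_add_cancel] at this
        have h1 : 1 + ‖x‖ ≤ (1 + ‖y‖) * (1 + d) := by
          have : 0 ≤ ‖y‖ * d := by positivity
          linarith
        have h2 : exp (-c * ((1 + ‖y‖) * d)) ≤ exp (-(c / 2) * d) * exp (-κ * d) := by
          rw [← exp_add, exp_le_exp, hκdef]
          have : 0 ≤ c * (‖y‖ * d) := by positivity
          linarith
        calc (1 + ‖x‖) ^ n * exp (-c * ((1 + ‖y‖) * d))
            ≤ ((1 + ‖y‖) * (1 + d)) ^ n * (exp (-(c / 2) * d) * exp (-κ * d)) := by gcongr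
          _ = (1 + ‖y‖) ^ n * ((1 + d) ^ n * exp (-(c / 2) * d)) * exp (-κ * d) := by
              rw [mul_pow]; ring
          _ ≤ (1 + ‖y‖) ^ n * K * exp (-κ * d) := by
              gcongr
              exact HK d hd0
    _ = ENNReal.ofReal ((1 + ‖y‖) ^ n * K) *
          ∫⁻ x : EuclideanSpace ℝ (Fin n), ENNReal.ofReal (exp (-κ * ‖x - y‖)) :=
        lintegral_const_mul _ (by fun_prop)
    _ ≤ ENNReal.ofReal ((1 + ‖y‖) ^ n * K) * ENNReal.ofReal (C * κ⁻¹ ^ n) := by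
        gcongr
        exact H κ y hκ
    _ = _ := by
        rw [← ENNReal.ofReal_mul (by positivity), hκdef]
        congr 1
        have : (c / 2 * (1 + ‖y‖))⁻¹ = (2 / c) * (1 + ‖y‖)⁻¹ := by field_simp
        rw [this, mul_pow, inv_pow]
        field_simp

theorem lintegral_gammaM1 (n : ℕ) {g : EuclideanSpace ℝ (Fin n) → ℝ≥0∞} (hg : Measurable g) :
    ∫⁻ y, g y ∂gammaM1 n =
      ENNReal.ofReal (π ^ ((n : ℝ) / 2)) * ∫⁻ y, ENNReal.ofReal (exp (‖y‖ ^ 2)) * g y := by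
  rw [gammaM1, lintegral_withDensity_eq_lintegral_mul _ (by fun_prop) hg,
    ← lintegral_const_mul' _ _ ENNReal.ofReal_ne_top]
  refine lintegral_congr fun y => ?_
  rw [Pi.mul_apply, ENNReal.ofReal_mul (by positivity), mul_assoc]

theorem weakType_expKernel (n : ℕ) {c : ℝ} (hc : 0 < c) :
    ∃ C : ℝ, 0 < C ∧ ∀ f : EuclideanSpace ℝ (Fin n) → ℝ≥0∞, Measurable f →
      ∀ lam : ℝ, 0 < lam →
      gammaM1 n {x | ENNReal.ofReal lam ≤ ENNReal.ofReal (exp (-‖x‖ ^ 2)) *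
          ∫⁻ y, ENNReal.ofReal ((1 + ‖x‖) ^ n * exp (-c * ((1 + ‖y‖) * ‖x - y‖))) * f y} ≤
        ENNReal.ofReal (C / lam) * ∫⁻ y, f y := by
  obtain ⟨C, hC, H⟩ := exists_lintegral_expKernel_le n hc
  refine ⟨π ^ ((n : ℝ) / 2) * C, by positivity, fun f hf lam hlam => ?_⟩
  set F : EuclideanSpace ℝ (Fin n) → EuclideanSpace ℝ (Fin n) → ℝ≥0∞ := fun x y =>
    ENNReal.ofReal ((1 + ‖x‖) ^ n * exp (-c * ((1 + ‖y‖) * ‖x - y‖))) * f y with hF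
  have hFm : Measurable (Function.uncurry F) := by
    simp only [hF, Function.uncurry_def]
    fun_prop
  have hIm : Measurable fun x => ENNReal.ofReal (exp (-‖x‖ ^ 2)) * ∫⁻ y, F x y :=
    (by fun_prop : Measurable fun x : EuclideanSpace ℝ (Fin n) =>
      ENNReal.ofReal (exp (-‖x‖ ^ 2))).mul hFm.lintegral_prod_right'
  have h1 := mul_meas_ge_le_lintegral (μ := gammaM1 n) hIm (ENNReal.ofReal lam)
  have h2 : ∫⁻ x, ENNReal.ofReal (exp (-‖x‖ ^ 2)) * (∫⁻ y, F x y) ∂gammaM1 n ≤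
      ENNReal.ofReal (π ^ ((n : ℝ) / 2) * C) * ∫⁻ y, f y := by
    rw [lintegral_gammaM1 n hIm, ENNReal.ofReal_mul (by positivity), mul_assoc]
    gcongr
    calc ∫⁻ x, ENNReal.ofReal (exp (‖x‖ ^ 2)) * (ENNReal.ofReal (exp (-‖x‖ ^ 2)) * ∫⁻ y, F x y)
        = ∫⁻ x, ∫⁻ y, F x y := by
          refine lintegral_congr fun x => ?_
          rw [← mul_assoc, ← ENNReal.ofReal_mul (by positivity), ← exp_add, add_neg_cancel,
            exp_zero, ENNReal.ofReal_one, one_mul]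
      _ = ∫⁻ y, ∫⁻ x, F x y := lintegral_lintegral_swap hFm.aemeasurable
      _ ≤ ∫⁻ y, ENNReal.ofReal C * f y := by
          refine lintegral_mono fun y => ?_
          simp only [hF]
          rw [lintegral_mul_const _ (by fun_prop)]
          gcongr
          exact H y
      _ = _ := lintegral_const_mul _ hf
  have hl : ENNReal.ofReal lam ≠ 0 := by simpa using hlam
  rw [ENNReal.ofReal_div_of_pos hlam, ENNReal.div_eq_inv_mul, mul_assoc]
  exact (ENNReal.mul_le_iff_le_inv hl ENNReal.ofReal_ne_top).1 (h1.trans h2)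

theorem globalKernel_le (m : ℕ) :
    ∃ K : ℝ, 0 < K ∧ ∀ x y : EuclideanSpace ℝ (Fin (m + 1)),
      (⨆ (t : ℝ) (_ : 0 < t),
          ENNReal.ofReal (t * |deriv (fun s => heatKerA (m + 1) s x y) t|)) *
        Set.indicator ((localN (m + 1))ᶜ) (fun _ => (1 : ℝ≥0∞)) (x, y) ≤
      ENNReal.ofReal K * ENNReal.ofReal (exp (-‖x‖ ^ 2)) * ENNReal.ofReal (exp (‖y‖ ^ 2)) *
        (ENNReal.ofReal ((1 + ‖x‖) ^ (m + 1) * exp (-(1 / 12000) * ((1 + ‖y‖) * ‖x - y‖))) +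
          ENNReal.ofReal (coneKernel m x y)) := by
  obtain ⟨C, hC, H⟩ := mehlerMajorant_le m
  refine ⟨π ^ (-((m + 1 : ℕ) : ℝ) / 2) * (m + 5) * C, by positivity, fun x y => ?_⟩
  by_cases hxy : (x, y) ∈ localN (m + 1)
  · simp [hxy]
  rw [Set.indicator_of_mem (show (x, y) ∈ (localN (m + 1))ᶜ from hxy), mul_one]
  refine iSup₂_le fun t ht => ?_
  have hk := coneKernel_nonneg m x y
  rw [← ENNReal.ofReal_add (by positivity) hk, ← ENNReal.ofReal_mul (by positivity),
    ← ENNReal.ofReal_mul (by positivity), ← ENNReal.ofReal_mul (by positivity)]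
  refine ENNReal.ofReal_le_ofReal ((abs_deriv_heatKerA_le m ht x y).trans ?_)
  have hr1 : exp (-t) < 1 := by rw [exp_lt_one_iff]; linarith
  have h := H (exp (-t)) x y (exp_pos _) hr1 hxy
  have e : exp (‖y‖ ^ 2 - ‖x‖ ^ 2) = exp (-‖x‖ ^ 2) * exp (‖y‖ ^ 2) := by
    rw [← exp_add]; congr 1; ring
  rw [e]
  calc _ ≤ π ^ (-((m + 1 : ℕ) : ℝ) / 2) * (m + 5) * (exp (-‖x‖ ^ 2) * exp (‖y‖ ^ 2) *
        (C * ((1 + ‖x‖) ^ (m + 1) * exp (-(1 / 12000) * ((1 + ‖y‖) * ‖x - y‖)) +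
          coneKernel m x y))) := by gcongr
    _ = _ := by ring

/-- The operator
`g ↦ ∫ sup_{t>0} |t ∂_t T_t^𝒜(x,y)| χ_{Nᶜ}(x,y) g(y) dy`
is of weak type (1,1) with respect to `γ₋₁`. -/
theorem stmt15 (n : ℕ) (hn : 1 ≤ n) :
    ∃ C : ℝ, 0 < C ∧ ∀ g : EuclideanSpace ℝ (Fin n) → ℝ≥0∞, Measurable g →
      (∫⁻ y, g y ∂gammaM1 n) ≠ ⊤ → ∀ lam : ℝ, 0 < lam →
      gammaM1 n {x | ENNReal.ofReal lam <
          ∫⁻ y, (⨆ (t : ℝ) (_ : 0 < t),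
              ENNReal.ofReal (t * |deriv (fun s => heatKerA n s x y) t|)) *
            Set.indicator ((localN n)ᶜ) (fun _ => (1 : ℝ≥0∞)) (x, y) * g y ∂volume}
        ≤ ENNReal.ofReal (C / lam) * ∫⁻ y, g y ∂gammaM1 n := by
  obtain ⟨m, rfl⟩ : ∃ m, n = m + 1 := ⟨n - 1, by omega⟩
  obtain ⟨K, hK, HK⟩ := globalKernel_le m
  obtain ⟨C₁, hC₁, H₁⟩ := weakType_expKernel (m + 1) (c := 1 / 12000) (by norm_num)
  obtain ⟨C₂, hC₂, H₂⟩ := weakType_coneKernel m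
  set p : ℝ := π ^ (((m + 1 : ℕ) : ℝ) / 2) with hp
  have hp0 : 0 < p := by positivity
  refine ⟨(C₁ + C₂) * (2 * K) * p⁻¹, by positivity, fun g hg hgi lam hlam => ?_⟩
  set f : EuclideanSpace ℝ (Fin (m + 1)) → ℝ≥0∞ :=
    fun y => ENNReal.ofReal (exp (‖y‖ ^ 2)) * g y with hf
  have hfm : Measurable f := by fun_prop
  have hgf : ∫⁻ y, g y ∂gammaM1 (m + 1) = ENNReal.ofReal p * ∫⁻ y, f y := lintegral_gammaM1 _ hg
  have hfg : ∫⁻ y, f y = ENNReal.ofReal p⁻¹ * ∫⁻ y, g y ∂gammaM1 (m + 1) := by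
    rw [hgf, ← mul_assoc, ← ENNReal.ofReal_mul (by positivity), inv_mul_cancel₀ hp0.ne',
      ENNReal.ofReal_one, one_mul]
  have hfi : ∫⁻ y, f y ≠ ⊤ := hfg ▸ ENNReal.mul_ne_top ENNReal.ofReal_ne_top hgi
  have hlam' : 0 < lam / (2 * K) := by positivity
  have h₁ := H₁ f hfm _ hlam'
  have h₂ := H₂ f hfi _ hlam'
  refine le_trans (measure_mono fun x hx => ?_) ((measure_union_le _ _).trans
    ((add_le_add h₁ h₂).trans (le_of_eq ?_)))
  · by_contra hnot
    simp only [Set.mem_union, Set.mem_ofPred_eq, not_or, not_le, not_lt] at hnot hx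
    refine absurd hx (not_lt.2 ?_)
    set G : EuclideanSpace ℝ (Fin (m + 1)) → ℝ≥0∞ := fun y =>
      ENNReal.ofReal ((1 + ‖x‖) ^ (m + 1) * exp (-(1 / 12000) * ((1 + ‖y‖) * ‖x - y‖))) * f y
      with hG
    have hGm : Measurable G := by fun_prop
    set B : EuclideanSpace ℝ (Fin (m + 1)) → ℝ≥0∞ := fun y =>
      ENNReal.ofReal (coneKernel m x y) * f y with hB
    calc _ ≤ ∫⁻ y, ENNReal.ofReal K * ENNReal.ofReal (exp (-‖x‖ ^ 2)) * (G y + B y) := by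
          refine lintegral_mono fun y => ?_
          refine (mul_le_mul_left (HK x y) (g y)).trans (le_of_eq ?_)
          simp only [hG, hB, hf]
          ring
      _ = ENNReal.ofReal K * (ENNReal.ofReal (exp (-‖x‖ ^ 2)) * (∫⁻ y, G y) +
            ENNReal.ofReal (exp (-‖x‖ ^ 2)) * ∫⁻ y, B y) := by
          rw [lintegral_const_mul' _ _ (ENNReal.mul_ne_top ENNReal.ofReal_ne_top
            ENNReal.ofReal_ne_top), lintegral_add_left hGm, mul_assoc, mul_add]
      _ ≤ ENNReal.ofReal K * (ENNReal.ofReal (lam / (2 * K)) + ENNReal.ofReal (lam / (2 * K))) := by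
          gcongr
          · exact hnot.1.le
          · exact hnot.2
      _ = ENNReal.ofReal lam := by
          rw [← ENNReal.ofReal_add hlam'.le hlam'.le, ← ENNReal.ofReal_mul hK.le]
          congr 1
          field_simp
          norm_num
  · rw [← add_mul, ← ENNReal.ofReal_add (by positivity) (by positivity), hfg, ← mul_assoc,
      ← ENNReal.ofReal_mul (by positivity)]
    congr 2
    field_simp
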